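/- If U and U′ are standard tableaux of the same shape μ (a partition of m with at most n rows), then S_U(z) = S_{U′}(z) for all z ∈ ℂ; that is, the q-immanant polynomial depends only on the Young diagram μ and not on the choice of standard μ-tableau. -/

import Mathlib

open scoped Classical

noncomputable section

namespace QImm

/-- `q` is not a root of unity. -/
def NotRootOfUnity (q : ℂ) : Prop := ∀ k : ℕ, 0 < k → q ^ k ≠ 1

/-! ### The R-matrices -/

/-- The R-matrix `R = q ∑ eᵢᵢ⊗eᵢᵢ + ∑_{i≠j} eᵢᵢ⊗eⱼⱼ + (q-q⁻¹) ∑_{i<j} eᵢⱼ⊗eⱼᵢ`. -/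
def Rmat (q : ℂ) (n : ℕ) : Matrix (Fin n × Fin n) (Fin n × Fin n) ℂ := fun p r =>
  if p.1 = r.1 ∧ p.2 = r.2 then (if p.1 = p.2 then q else 1)
  else if p.2 = r.1 ∧ p.1 = r.2 ∧ p.1 < r.1 then q - q⁻¹ else 0

/-- The permutation operator `P = ∑ eᵢⱼ⊗eⱼᵢ`. -/
def Pmat (n : ℕ) : Matrix (Fin n × Fin n) (Fin n × Fin n) ℂ := fun p r =>
  if p.1 = r.2 ∧ p.2 = r.1 then 1 else 0

/-- `Ř = P R`. -/
def Rcheck (q : ℂ) (n : ℕ) : Matrix (Fin n × Fin n) (Fin n × Fin n) ℂ :=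
  Pmat n * Rmat q n

/-! ### Embeddings into tensor legs: `(End ℂⁿ)^{⊗m} ⊗ A ≅ Matrix (Fin m → Fin n) (Fin m → Fin n) A` -/

/-- An `n×n` matrix over `A` placed in the `a`-th tensor leg (0-indexed) of
`(End ℂⁿ)^{⊗m} ⊗ A`. -/
def leg1 {A : Type} [Ring A] (n m : ℕ) (X : Matrix (Fin n) (Fin n) A) (a : ℕ) :
    Matrix (Fin m → Fin n) (Fin m → Fin n) A := fun i j =>
  if h : a < m then
    if ∀ c : Fin m, (c : ℕ) ≠ a → i c = j c then X (i ⟨a, h⟩) (j ⟨a, h⟩) else 0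
  else 0

/-- A scalar element of `End ℂⁿ ⊗ End ℂⁿ` placed in the `a`-th and `b`-th tensor legs
(0-indexed) of `(End ℂⁿ)^{⊗m} ⊗ A`. -/
def leg2 (A : Type) [Ring A] [Algebra ℂ A] (n m : ℕ)
    (C : Matrix (Fin n × Fin n) (Fin n × Fin n) ℂ) (a b : ℕ) :
    Matrix (Fin m → Fin n) (Fin m → Fin n) A := fun i j =>
  if h : a < m ∧ b < m then
    if ∀ c : Fin m, (c : ℕ) ≠ a → (c : ℕ) ≠ b → i c = j c then
      algebraMap ℂ A (C (i ⟨a, h.1⟩, i ⟨b, h.2⟩) (j ⟨a, h.1⟩, j ⟨b, h.2⟩))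
    else 0
  else 0

/-- `Ř_{k+1}` (paper numbering), acting in the tensor legs `k`, `k+1` (0-indexed). -/
def RcLeg (A : Type) [Ring A] [Algebra ℂ A] (q : ℂ) (n m : ℕ) (k : ℕ) :
    Matrix (Fin m → Fin n) (Fin m → Fin n) A :=
  leg2 A n m (Rcheck q n) k (k + 1)

/-- `Ř⁻¹_{k+1}` (paper numbering), acting in the tensor legs `k`, `k+1` (0-indexed). -/
def RcLegInv (A : Type) [Ring A] [Algebra ℂ A] (q : ℂ) (n m : ℕ) (k : ℕ) :
    Matrix (Fin m → Fin n) (Fin m → Fin n) A :=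
  leg2 A n m (Rcheck q n)⁻¹ k (k + 1)

/-- `legBar q n m X k` is `X_{\overline{k+1}}` (paper numbering), so `legBar q n m X 0 = X₁`
and `X_{\overline{k+1}} = Ř_k X_{\overline{k}} Ř_k⁻¹`. -/
def legBar {A : Type} [Ring A] [Algebra ℂ A] (q : ℂ) (n m : ℕ)
    (X : Matrix (Fin n) (Fin n) A) : ℕ → Matrix (Fin m → Fin n) (Fin m → Fin n) A
  | 0 => leg1 n m X 0
  | k + 1 => RcLeg A q n m k * legBar q n m X k * RcLegInv A q n m k

/-! ### q-traces -/

/-- The q-trace over all `m` tensor legs: `tr_{q(1,…,m)} Y = tr D₁⋯D_m Y` with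
`D = diag(1, q⁻², …, q^{-2n+2})`. -/
def qTr {A : Type} [Ring A] [Algebra ℂ A] (q : ℂ) (n m : ℕ)
    (Y : Matrix (Fin m → Fin n) (Fin m → Fin n) A) : A :=
  ∑ i : Fin m → Fin n,
    algebraMap ℂ A (∏ a : Fin m, q ^ (-2 * ((i a : ℕ) : ℤ))) * Y i i

/-- The q-trace of a single `n×n` matrix: `tr_q X = tr D X`. -/
def qTr1 {A : Type} [Ring A] [Algebra ℂ A] (q : ℂ) (n : ℕ)
    (X : Matrix (Fin n) (Fin n) A) : A :=
  ∑ j : Fin n, algebraMap ℂ A (q ^ (-2 * ((j : ℕ) : ℤ))) * X j j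

/-! ### The Hecke algebra -/

/-- The defining relations of the Hecke algebra `H_m` on generators `T_1, …, T_{m-1}`
(the generator `i : Fin (m-1)` is `T_{i+1}` in 1-indexed paper notation). -/
inductive HeckeRel (q : ℂ) (m : ℕ) :
    FreeAlgebra ℂ (Fin (m - 1)) → FreeAlgebra ℂ (Fin (m - 1)) → Prop
  | quad (i : Fin (m - 1)) :
      HeckeRel q m
        ((FreeAlgebra.ι ℂ i - algebraMap ℂ (FreeAlgebra ℂ (Fin (m - 1))) q) *
          (FreeAlgebra.ι ℂ i + algebraMap ℂ (FreeAlgebra ℂ (Fin (m - 1))) q⁻¹)) 0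
  | braid (i j : Fin (m - 1)) (h : (j : ℕ) = (i : ℕ) + 1) :
      HeckeRel q m (FreeAlgebra.ι ℂ i * FreeAlgebra.ι ℂ j * FreeAlgebra.ι ℂ i)
        (FreeAlgebra.ι ℂ j * FreeAlgebra.ι ℂ i * FreeAlgebra.ι ℂ j)
  | commute (i j : Fin (m - 1)) (h : (i : ℕ) + 1 < (j : ℕ)) :
      HeckeRel q m (FreeAlgebra.ι ℂ i * FreeAlgebra.ι ℂ j)
        (FreeAlgebra.ι ℂ j * FreeAlgebra.ι ℂ i)

/-- The Hecke algebra `H_m`. -/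
abbrev Hecke (q : ℂ) (m : ℕ) := RingQuot (HeckeRel q m)

/-- The generator `T_{i+1}` (paper 1-indexed) of `H_m`. -/
def Tgen (q : ℂ) (m : ℕ) (i : Fin (m - 1)) : Hecke q m :=
  RingQuot.mkAlgHom ℂ (HeckeRel q m) (FreeAlgebra.ι ℂ i)

/-- `T_{k+1}` (paper 1-indexed), i.e. the 0-indexed `k`-th generator; junk value `1`
out of range. -/
def Tn (q : ℂ) (m : ℕ) (k : ℕ) : Hecke q m :=
  if h : k < m - 1 then Tgen q m ⟨k, h⟩ else 1

/-- The paper's 1-indexed generator `T_a`, `a = 1, …, m-1`. -/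
def Tp (q : ℂ) (m : ℕ) (a : ℕ) : Hecke q m := Tn q m (a - 1)

/-- The Jucys–Murphy elements, 1-indexed: `y_1 = 1`, `y_{k+1} = T_k ⋯ T_2 T_1² T_2 ⋯ T_k`
(the value at `0` is a junk value `1`). -/
def yJM (q : ℂ) (m : ℕ) : ℕ → Hecke q m
  | 0 => 1
  | 1 => 1
  | k + 2 => Tp q m (k + 1) * yJM q m (k + 1) * Tp q m (k + 1)

/-- The element `T_{(i,j)} = T_i T_{i+1} ⋯ T_{j-2} T_{j-1} T_{j-2} ⋯ T_{i+1} T_i` of `H_m`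
associated with the transposition `(i,j)`, `1 ≤ i < j` (paper 1-indexed). -/
def Ttrans (q : ℂ) (m : ℕ) (i j : ℕ) : Hecke q m :=
  ((List.range' i (j - i)).map (Tp q m)).prod *
    (((List.range' i (j - 1 - i)).map (Tp q m)).reverse).prod

/-- The condition that `φ : H_m → End((ℂⁿ)^{⊗m})` is the algebra homomorphism sending
`T_k ↦ Ř_k`. -/
def IsHeckeRep (q : ℂ) (n m : ℕ)
    (φ : Hecke q m →ₐ[ℂ] Matrix (Fin m → Fin n) (Fin m → Fin n) ℂ) : Prop :=
  ∀ k : ℕ, k < m - 1 → φ (Tn q m k) = RcLeg ℂ q n m k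

/-! ### Young diagrams and standard tableaux -/

/-- The content `c(α) = j - i` of a box `α = (i, j)` (row `i`, column `j`, 0-indexed). -/
def ctn (α : ℕ × ℕ) : ℤ := (α.2 : ℤ) - (α.1 : ℤ)

/-- A standard tableau of shape `μ` with `m` boxes, recorded via the position `pos k` of
each entry `k ∈ {1, …, m}`; entries strictly increase along rows and down columns. -/
structure StdTab (μ : YoungDiagram) (m : ℕ) where
  pos : ℕ → ℕ × ℕ
  bij : Set.BijOn pos (Set.Icc 1 m) (μ.cells : Set (ℕ × ℕ))
  row_lt : ∀ k ∈ Set.Icc 1 m, ∀ l ∈ Set.Icc 1 m,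
    (pos k).1 = (pos l).1 → (pos k).2 < (pos l).2 → k < l
  col_lt : ∀ k ∈ Set.Icc 1 m, ∀ l ∈ Set.Icc 1 m,
    (pos k).2 = (pos l).2 → (pos k).1 < (pos l).1 → k < l

/-- `c_k(U)`, the content of the box of `U` occupied by `k`. -/
def ctnAt {μ : YoungDiagram} {m : ℕ} (U : StdTab μ m) (k : ℕ) : ℤ := ctn (U.pos k)

/-- The condition singling out the primitive idempotent `e_U` of `H_m` associated with a
standard tableau `U`: a nonzero idempotent with `y_k e_U = e_U y_k = q^{2c_k(U)} e_U`. -/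
def IsJMIdem (q : ℂ) (m : ℕ) {μ : YoungDiagram} (U : StdTab μ m) (e : Hecke q m) : Prop :=
  e ≠ 0 ∧ e * e = e ∧ ∀ k : ℕ, 1 ≤ k → k ≤ m →
    yJM q m k * e = (q ^ (2 * ctnAt U k) : ℂ) • e ∧
    e * yJM q m k = (q ^ (2 * ctnAt U k) : ℂ) • e

/-! ### The quantized enveloping algebra `U_q(gl_n)` -/

/-- Generators: `inl (i,j) ↦ l⁺_{ij}`, `inr (i,j) ↦ l⁻_{ij}`. -/
abbrev UqGen (n : ℕ) := (Fin n × Fin n) ⊕ (Fin n × Fin n)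

def lpF (n : ℕ) (i j : Fin n) : FreeAlgebra ℂ (UqGen n) := FreeAlgebra.ι ℂ (Sum.inl (i, j))
def lmF (n : ℕ) (i j : Fin n) : FreeAlgebra ℂ (UqGen n) := FreeAlgebra.ι ℂ (Sum.inr (i, j))

/-- A matrix `X` over `F` placed in the first of two matrix legs of
`End ℂⁿ ⊗ End ℂⁿ ⊗ F`. -/
def M1 {F : Type} [Ring F] {n : ℕ} (X : Fin n → Fin n → F) :
    Matrix (Fin n × Fin n) (Fin n × Fin n) F := fun p r => if p.2 = r.2 then X p.1 r.1 else 0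

/-- A matrix `X` over `F` placed in the second of two matrix legs of
`End ℂⁿ ⊗ End ℂⁿ ⊗ F`. -/
def M2 {F : Type} [Ring F] {n : ℕ} (X : Fin n → Fin n → F) :
    Matrix (Fin n × Fin n) (Fin n × Fin n) F := fun p r => if p.1 = r.1 then X p.2 r.2 else 0

/-- The R-matrix, viewed over the free algebra on the generators of `U_q(gl_n)`. -/
def RmatU (q : ℂ) (n : ℕ) : Matrix (Fin n × Fin n) (Fin n × Fin n) (FreeAlgebra ℂ (UqGen n)) :=
  (Rmat q n).map (algebraMap ℂ (FreeAlgebra ℂ (UqGen n)))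

/-- The defining relations of `U_q(gl_n)`. -/
inductive UqRel (q : ℂ) (n : ℕ) :
    FreeAlgebra ℂ (UqGen n) → FreeAlgebra ℂ (UqGen n) → Prop
  | upperZero (i j : Fin n) (h : j < i) : UqRel q n (lpF n i j) 0
  | lowerZero (i j : Fin n) (h : i < j) : UqRel q n (lmF n i j) 0
  | diagPM (i : Fin n) : UqRel q n (lpF n i i * lmF n i i) 1
  | diagMP (i : Fin n) : UqRel q n (lmF n i i * lpF n i i) 1
  | rllPP (x y : Fin n × Fin n) :
      UqRel q n ((RmatU q n * M1 (lpF n) * M2 (lpF n)) x y)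
        ((M2 (lpF n) * M1 (lpF n) * RmatU q n) x y)
  | rllMM (x y : Fin n × Fin n) :
      UqRel q n ((RmatU q n * M1 (lmF n) * M2 (lmF n)) x y)
        ((M2 (lmF n) * M1 (lmF n) * RmatU q n) x y)
  | rllPM (x y : Fin n × Fin n) :
      UqRel q n ((RmatU q n * M1 (lpF n) * M2 (lmF n)) x y)
        ((M2 (lmF n) * M1 (lpF n) * RmatU q n) x y)

/-- The quantized enveloping algebra `U_q(gl_n)`. -/
abbrev Uq (q : ℂ) (n : ℕ) := RingQuot (UqRel q n)

def lp (q : ℂ) (n : ℕ) (i j : Fin n) : Uq q n := RingQuot.mkAlgHom ℂ (UqRel q n) (lpF n i j)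
def lm (q : ℂ) (n : ℕ) (i j : Fin n) : Uq q n := RingQuot.mkAlgHom ℂ (UqRel q n) (lmF n i j)

/-- The matrix `L⁺`. -/
def Lp (q : ℂ) (n : ℕ) : Matrix (Fin n) (Fin n) (Uq q n) := Matrix.of fun i j => lp q n i j
/-- The matrix `L⁻`. -/
def Lm (q : ℂ) (n : ℕ) : Matrix (Fin n) (Fin n) (Uq q n) := Matrix.of fun i j => lm q n i j

/-- `L = L⁺ (L⁻)⁻¹`, where `K` is the (two-sided) inverse of `L⁻`. -/
def Lmat (q : ℂ) (n : ℕ) (K : Matrix (Fin n) (Fin n) (Uq q n)) :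
    Matrix (Fin n) (Fin n) (Uq q n) := Lp q n * K

/-! ### The braided Weyl algebra -/

/-- Generators: `inl (i,j) ↦ m_{ij}`, `inr (i,j) ↦ ∂_{ij}`. -/
abbrev WGen (n : ℕ) := (Fin n × Fin n) ⊕ (Fin n × Fin n)

def mgF (n : ℕ) (i j : Fin n) : FreeAlgebra ℂ (WGen n) := FreeAlgebra.ι ℂ (Sum.inl (i, j))
def dgF (n : ℕ) (i j : Fin n) : FreeAlgebra ℂ (WGen n) := FreeAlgebra.ι ℂ (Sum.inr (i, j))

def RcW (q : ℂ) (n : ℕ) : Matrix (Fin n × Fin n) (Fin n × Fin n) (FreeAlgebra ℂ (WGen n)) :=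
  (Rcheck q n).map (algebraMap ℂ (FreeAlgebra ℂ (WGen n)))

def RcWInv (q : ℂ) (n : ℕ) : Matrix (Fin n × Fin n) (Fin n × Fin n) (FreeAlgebra ℂ (WGen n)) :=
  ((Rcheck q n)⁻¹).map (algebraMap ℂ (FreeAlgebra ℂ (WGen n)))

/-- The defining relations of the braided Weyl algebra `W_n`. -/
inductive WRel (q : ℂ) (n : ℕ) :
    FreeAlgebra ℂ (WGen n) → FreeAlgebra ℂ (WGen n) → Prop
  | mm (x y : Fin n × Fin n) :
      WRel q n ((RcW q n * M1 (mgF n) * RcW q n * M1 (mgF n)) x y)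
        ((M1 (mgF n) * RcW q n * M1 (mgF n) * RcW q n) x y)
  | dd (x y : Fin n × Fin n) :
      WRel q n ((RcWInv q n * M1 (dgF n) * RcWInv q n * M1 (dgF n)) x y)
        ((M1 (dgF n) * RcWInv q n * M1 (dgF n) * RcWInv q n) x y)
  | dm (x y : Fin n × Fin n) :
      WRel q n ((M1 (dgF n) * RcW q n * M1 (mgF n)) x y)
        ((RcW q n * M1 (mgF n) * RcWInv q n * M1 (dgF n) * RcWInv q n + 1) x y)

/-- The braided Weyl algebra `W_n`. -/
abbrev Weyl (q : ℂ) (n : ℕ) := RingQuot (WRel q n)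

def mW (q : ℂ) (n : ℕ) (i j : Fin n) : Weyl q n := RingQuot.mkAlgHom ℂ (WRel q n) (mgF n i j)
def dW (q : ℂ) (n : ℕ) (i j : Fin n) : Weyl q n := RingQuot.mkAlgHom ℂ (WRel q n) (dgF n i j)

/-- The matrix `M = [m_{ij}]` over `W_n`. -/
def Mmat (q : ℂ) (n : ℕ) : Matrix (Fin n) (Fin n) (Weyl q n) := Matrix.of fun i j => mW q n i j
/-- The matrix `𝒟 = [∂_{ij}]` over `W_n`. -/
def Dmat (q : ℂ) (n : ℕ) : Matrix (Fin n) (Fin n) (Weyl q n) := Matrix.of fun i j => dW q n i j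

/-- The image `L = M𝒟 - (q - q⁻¹)⁻¹·1` of `L` in the braided Weyl algebra. -/
def LW (q : ℂ) (n : ℕ) : Matrix (Fin n) (Fin n) (Weyl q n) :=
  Mmat q n * Dmat q n - ((q - q⁻¹)⁻¹ : ℂ) • 1

/-! ### The q-immanant polynomials -/

/-- The matrix `(L_{1̄} + z q^{-2c₁(U)}) ⋯ (L_{m̄} + z q^{-2c_m(U)}) E_U`, where `E` is the
image `E_U` of the primitive idempotent `e_U`. -/
def prodU {A : Type} [Ring A] [Algebra ℂ A] (q : ℂ) (n m : ℕ) {μ : YoungDiagram}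
    (U : StdTab μ m) (E : Matrix (Fin m → Fin n) (Fin m → Fin n) ℂ)
    (X : Matrix (Fin n) (Fin n) A) (z : ℂ) :
    Matrix (Fin m → Fin n) (Fin m → Fin n) A :=
  (((List.range m).map fun k =>
      legBar q n m X k + ((z * q ^ (-2 * ctnAt U (k + 1))) : ℂ) • 1)).prod *
    E.map (algebraMap ℂ A)

/-- The q-immanant polynomial
`S_U(z) = tr_{q(1,…,m)} (L_{1̄} + z q^{-2c₁(U)}) ⋯ (L_{m̄} + z q^{-2c_m(U)}) E_U`. -/
def SUpoly {A : Type} [Ring A] [Algebra ℂ A] (q : ℂ) (n m : ℕ) {μ : YoungDiagram}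
    (U : StdTab μ m) (E : Matrix (Fin m → Fin n) (Fin m → Fin n) ℂ)
    (X : Matrix (Fin n) (Fin n) A) (z : ℂ) : A :=
  qTr q n m (prodU q n m U E X z)

/-- The coefficient `a_μ = ∏_{α ∈ μ} q^{-2c(α)}`. -/
def aCoeff (q : ℂ) (μ : YoungDiagram) : ℂ := ∏ α ∈ μ.cells, q ^ (-2 * ctn α)

/-- `tr_{q(1,…,m)} L_{1̄} ⋯ L_{m̄} E_{(1^m)}`, where `Em` is the image of the primitive
idempotent associated with the column diagram `(1^m)`. -/
def colElem (q : ℂ) (n k : ℕ) (K : Matrix (Fin n) (Fin n) (Uq q n))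
    (φk : Hecke q k →ₐ[ℂ] Matrix (Fin k → Fin n) (Fin k → Fin n) ℂ)
    (ek : Hecke q k) : Uq q n :=
  qTr q n k (((List.range k).map fun j => legBar q n k (Lmat q n K) j).prod *
    (φk ek).map (algebraMap ℂ (Uq q n)))

/-- The semistandardness condition on a filling of the boxes of `μ` with entries in
`{1, …, n}` (encoded as `Fin n`): weakly increasing along rows, strictly increasing
down columns. -/
def SSYTCond {n : ℕ} (μ : YoungDiagram) (f : {x // x ∈ μ.cells} → Fin n) : Prop :=
  (∀ a b : {x // x ∈ μ.cells}, (a : ℕ × ℕ).1 = (b : ℕ × ℕ).1 →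
    (a : ℕ × ℕ).2 ≤ (b : ℕ × ℕ).2 → f a ≤ f b) ∧
  (∀ a b : {x // x ∈ μ.cells}, (a : ℕ × ℕ).2 = (b : ℕ × ℕ).2 →
    (a : ℕ × ℕ).1 < (b : ℕ × ℕ).1 → f a < f b)

/-- The factorial Schur polynomial `s_μ(x₁,…,x_n | a)` evaluated at `x_i = q^{2ℓ_i}`,
`ℓ_i = λ_i - i + 1` (1-indexed), with parameter sequence `a_j = z q^{1-2j}`. -/
def factSchur {n : ℕ} (q z : ℂ) (lam : Fin n → ℤ) (μ : YoungDiagram) : ℂ :=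
  ∑ f : {x // x ∈ μ.cells} → Fin n,
    if SSYTCond μ f then
      ∏ α : {x // x ∈ μ.cells},
        (q ^ (2 * (lam (f α) - ((f α : ℕ) : ℤ))) +
          z * q ^ (1 - 2 * (((f α : ℕ) : ℤ) + 1 + ctn (α : ℕ × ℕ))))
    else 0

/-! ### Profiles of content sequences -/

/-- The profile of the diagram filled by the contents `a 1, …, a s`: a function on the
diagonals whose local minima are the addable boxes and whose local maxima are the removable
boxes. -/
def profile (a : ℕ → ℤ) : ℕ → ℤ → ℤ
  | 0, d => |d|
  | s + 1, d => profile a s d + if a (s + 1) = d then 2 else 0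

def LocMin (f : ℤ → ℤ) (d : ℤ) : Prop := f (d - 1) = f d + 1 ∧ f (d + 1) = f d + 1

def LocMax (f : ℤ → ℤ) (d : ℤ) : Prop := f (d - 1) = f d - 1 ∧ f (d + 1) = f d - 1

/-- The first `s` terms of `a` are the contents of successively added addable boxes. -/
def IsContentSeq (a : ℕ → ℤ) (s : ℕ) : Prop := ∀ k < s, LocMin (profile a k) (a (k + 1))

/-- `b` is obtained from `a` by an admissible transposition of two neighbours among the first
`r` terms. -/
def AdmSwap (r : ℕ) (a b : ℕ → ℤ) : Prop :=
  ∃ k, 1 ≤ k ∧ k + 1 ≤ r ∧ 2 ≤ |a k - a (k + 1)| ∧ b = a ∘ Equiv.swap k (k + 1)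

lemma profile_congr {a b : ℕ → ℤ} {s : ℕ} (h : ∀ k, 1 ≤ k → k ≤ s → a k = b k) :
    profile a s = profile b s := by
  induction s with
  | zero => rfl
  | succ s ih =>
    funext d
    simp only [profile]
    rw [ih fun k h1 h2 => h k h1 (by omega), h (s + 1) (by omega) le_rfl]

lemma profile_eq_sum (a : ℕ → ℤ) (s : ℕ) (d : ℤ) :
    profile a s d = |d| + ∑ k ∈ Finset.Icc 1 s, if a k = d then 2 else 0 := by
  induction s with
  | zero => simp [profile]
  | succ s ih => rw [profile, ih, Finset.sum_Icc_succ_top (by omega)]; ring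

lemma swap_apply_of_gt {k r j : ℕ} (h : k + 1 ≤ r) (hj : r < j) :
    Equiv.swap k (k + 1) j = j :=
  Equiv.swap_apply_of_ne_of_ne (by omega) (by omega)

lemma AdmSwap.mono {r s : ℕ} (hrs : r ≤ s) {a b : ℕ → ℤ} (h : AdmSwap r a b) :
    AdmSwap s a b := by
  obtain ⟨k, h1, h2, h3⟩ := h
  exact ⟨k, h1, h2.trans hrs, h3⟩

lemma AdmSwap.apply_of_gt {r j : ℕ} {a b : ℕ → ℤ} (h : AdmSwap r a b) (hj : r < j) :
    b j = a j := by
  obtain ⟨k, h1, h2, -, rfl⟩ := h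
  simp [swap_apply_of_gt h2 hj]

lemma AdmSwap.profile_eq {r : ℕ} {a b : ℕ → ℤ} (h : AdmSwap r a b) :
    profile b r = profile a r := by
  obtain ⟨k, h1, h2, -, rfl⟩ := h
  funext d
  rw [profile_eq_sum, profile_eq_sum]
  congr 1
  refine Finset.sum_bij' (fun j _ => Equiv.swap k (k + 1) j)
    (fun j _ => Equiv.swap k (k + 1) j) ?_ ?_ ?_ ?_ ?_
  · intro j hj
    simp only [Finset.mem_Icc, Equiv.swap_apply_def] at hj ⊢
    split_ifs <;> omega
  · intro j hj
    simp only [Finset.mem_Icc, Equiv.swap_apply_def] at hj ⊢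
    split_ifs <;> omega
  all_goals simp

abbrev AdmReach (r : ℕ) : (ℕ → ℤ) → (ℕ → ℤ) → Prop := Relation.ReflTransGen (AdmSwap r)

lemma AdmReach.mono {r s : ℕ} (hrs : r ≤ s) {a b : ℕ → ℤ} (h : AdmReach r a b) :
    AdmReach s a b :=
  Relation.ReflTransGen.mono (fun _ _ h => AdmSwap.mono hrs h) _ _ h

lemma AdmReach.apply_of_gt {r j : ℕ} {a b : ℕ → ℤ} (h : AdmReach r a b) (hj : r < j) :
    b j = a j := by
  induction h with
  | refl => rfl
  | tail _ h ih => rw [h.apply_of_gt hj, ih]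

lemma AdmReach.profile_eq {r : ℕ} {a b : ℕ → ℤ} (h : AdmReach r a b) :
    profile b r = profile a r := by
  induction h with
  | refl => rfl
  | tail _ h ih => rw [h.profile_eq, ih]

lemma IsContentSeq.of_succ {a : ℕ → ℤ} {s : ℕ} (h : IsContentSeq a (s + 1)) :
    IsContentSeq a s := fun k hk => h k (by omega)

lemma IsContentSeq.profile_step {a : ℕ → ℤ} {s : ℕ} (h : IsContentSeq a s) (d : ℤ) :
    profile a s (d + 1) = profile a s d + 1 ∨ profile a s (d + 1) = profile a s d - 1 := by
  induction s with
  | zero =>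
    simp only [profile]
    rcases abs_cases d with h | h <;> rcases abs_cases (d + 1) with h' | h' <;> omega
  | succ s ih =>
    have h1 := ih h.of_succ
    obtain ⟨h2, h3⟩ := h s (by omega)
    simp only [profile]
    set c := a (s + 1)
    by_cases hd : c = d
    · subst hd; rw [if_pos rfl, if_neg (show ¬c = c + 1 by omega)]; omega
    · by_cases hd' : c = d + 1
      · have : d = c - 1 := by omega
        subst this
        rw [if_neg hd, if_pos hd']
        simp only [sub_add_cancel] at *; omega
      · rw [if_neg hd, if_neg hd']; omega

/-- A removable box of the final diagram can be moved to the last position by admissible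
transpositions. -/
lemma IsContentSeq.exists_reach_last {a : ℕ → ℤ} {r : ℕ} (h : IsContentSeq a r) {x : ℤ}
    (hx : LocMax (profile a r) x) : 1 ≤ r ∧ ∃ b, AdmReach r a b ∧ b r = x := by
  induction r with
  | zero =>
    simp only [LocMax, profile] at hx
    rcases abs_cases x with h | h <;> rcases abs_cases (x + 1) with h' | h' <;>
      rcases abs_cases (x - 1) with h'' | h'' <;> omega
  | succ r ih =>
    refine ⟨by omega, ?_⟩
    by_cases hc : a (r + 1) = x
    · exact ⟨a, .refl, hc⟩
    obtain ⟨h2, h3⟩ := h r (by omega)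
    obtain ⟨hx1, hx2⟩ := hx
    simp only [profile] at hx1 hx2
    have hne : a (r + 1) ≠ x - 1 := by
      intro e; rw [e] at h2 h3 hx1 hx2 hc
      simp only [sub_add_cancel] at *; simp at hx1; omega
    have hne' : a (r + 1) ≠ x + 1 := by
      intro e; rw [e] at h2 h3 hx1 hx2 hc
      simp only [add_sub_cancel_right] at *; simp at hx2; omega
    rw [if_neg hne, if_neg hc] at hx1
    rw [if_neg hne', if_neg hc] at hx2
    obtain ⟨hr, b, hb, hbr⟩ := ih h.of_succ ⟨by omega, by omega⟩
    refine ⟨b ∘ Equiv.swap r (r + 1), (hb.mono (by omega)).tail ⟨r, hr, le_rfl, ?_, rfl⟩, ?_⟩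
    · rw [hbr, hb.apply_of_gt (by omega)]
      rcases abs_cases (x - a (r + 1)) with h | h <;> omega
    · simp [hbr]

lemma LocMin.succ_of_ne {a : ℕ → ℤ} {s : ℕ} {b : ℤ} (hc : LocMin (profile a s) (a (s + 1)))
    (hb : LocMin (profile a s) b) (hne : b ≠ a (s + 1)) : LocMin (profile a (s + 1)) b := by
  obtain ⟨h1, h2⟩ := hc
  obtain ⟨h3, h4⟩ := hb
  have e1 : a (s + 1) ≠ b - 1 := by
    intro e; rw [e, sub_add_cancel] at h2; omega
  have e2 : a (s + 1) ≠ b + 1 := by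
    intro e; rw [e, add_sub_cancel_right] at h1; omega
  simp only [LocMin, profile, if_neg e1, if_neg e2, if_neg hne.symm]
  omega

lemma locMax_profile_succ {b : ℕ → ℤ} {r : ℕ} (h : LocMin (profile b r) (b (r + 1))) :
    LocMax (profile b (r + 1)) (b (r + 1)) := by
  obtain ⟨h1, h2⟩ := h
  simp only [LocMax, profile, if_pos]
  rw [if_neg (show ¬b (r + 1) = b (r + 1) - 1 by omega),
    if_neg (show ¬b (r + 1) = b (r + 1) + 1 by omega)]
  omega

/-- A neighbour of the last added box is either addable, or was removable before. -/
lemma locMin_or_locMax_of_adj {a : ℕ → ℤ} {s : ℕ} (h : IsContentSeq a (s + 1)) {x : ℤ}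
    (hx : x = a (s + 1) + 1 ∨ x = a (s + 1) - 1) :
    LocMin (profile a (s + 1)) x ∨ LocMax (profile a s) x := by
  obtain ⟨h1, h2⟩ := h s (by omega)
  have hw := h.of_succ.profile_step
  simp only [LocMin, LocMax, profile]
  set c := a (s + 1)
  obtain rfl | rfl := hx
  · have := hw (c + 1)
    rw [if_pos (show c = c + 1 - 1 by omega), if_neg (show ¬c = c + 1 by omega),
      if_neg (show ¬c = c + 1 + 1 by omega)]
    simp only [add_sub_cancel_right]; omega
  · have := hw (c - 1 - 1)
    rw [if_pos (show c = c - 1 + 1 by omega), if_neg (show ¬c = c - 1 by omega),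
      if_neg (show ¬c = c - 1 - 1 by omega)]
    simp only [sub_add_cancel] at *; omega

/-! ### Hecke systems and their Jucys–Murphy elements -/

/-- Elements `T 1, …, T (m - 1)` satisfying the relations of the Hecke algebra, with their
Jucys–Murphy elements `y 1, …, y m`. -/
structure HeckeSystem {B : Type} [Ring B] [Algebra ℂ B] (q : ℂ) (m : ℕ) (T y : ℕ → B) :
    Prop where
  sq : ∀ k, 1 ≤ k → k < m → T k * T k = (q - q⁻¹) • T k + 1
  braid : ∀ k, 1 ≤ k → k + 1 < m → T k * T (k + 1) * T k = T (k + 1) * T k * T (k + 1)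
  comm : ∀ k l, 1 ≤ k → k + 1 < l → l < m → Commute (T k) (T l)
  y_one : y 1 = 1
  y_succ : ∀ k, 1 ≤ k → y (k + 1) = T k * y k * T k

/-- The intertwining element exchanging `y k` and `y (k + 1)`. -/
def intertwiner {B : Type} [Ring B] [Algebra ℂ B] (q : ℂ) (T y : ℕ → B) (k : ℕ) : B :=
  T k * (y k - y (k + 1)) + (q - q⁻¹) • y (k + 1)

lemma HeckeSystem.map {B C : Type} [Ring B] [Algebra ℂ B] [Ring C] [Algebra ℂ C] {q : ℂ}
    {m : ℕ} {T y : ℕ → B} (H : HeckeSystem q m T y) (f : B →ₐ[ℂ] C) :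
    HeckeSystem q m (fun k => f (T k)) (fun k => f (y k)) where
  sq k h1 h2 := by rw [← map_mul, H.sq k h1 h2]; simp
  braid k h1 h2 := by simp only [← map_mul, H.braid k h1 h2]
  comm k l h1 h2 h3 := (H.comm k l h1 h2 h3).map f
  y_one := by simp [H.y_one]
  y_succ k h := by simp [H.y_succ k h]

/-- Elements `x 1, …, x m` with `x (k + 1) = T k * x k * S k`, where `S` is either `T` or its
inverse, subject to the relations under which `T l` commutes with `x k` for `k ≠ l, l + 1`. -/
structure BraidStrand {B : Type} [Monoid B] (m : ℕ) (T S x : ℕ → B) : Prop where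
  braid : ∀ k, 1 ≤ k → k + 1 < m → T k * T (k + 1) * T k = T (k + 1) * T k * T (k + 1)
  mixed : ∀ k, 1 ≤ k → k + 1 < m → T (k + 1) * (S k * S (k + 1)) = S k * S (k + 1) * T k
  comm : ∀ k l, 1 ≤ k → k + 1 < l → l < m → Commute (T k) (T l)
  comm_left : ∀ k l, 1 ≤ k → k + 1 < l → l < m → Commute (T k) (S l)
  comm_right : ∀ k l, 1 ≤ k → k + 1 < l → l < m → Commute (S k) (T l)
  base : ∀ k, 2 ≤ k → k < m → Commute (T k) (x 1)
  succ : ∀ k, 1 ≤ k → k < m → x (k + 1) = T k * x k * S k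

namespace BraidStrand

variable {B : Type} [Monoid B] {m : ℕ} {T S x : ℕ → B}

lemma commute_gt (H : BraidStrand m T S x) {k l : ℕ} (hk : 1 ≤ k) (hkl : k < l) (hl : l < m) :
    Commute (T l) (x k) := by
  induction k, hk using Nat.le_induction with
  | base => exact H.base l (by omega) hl
  | succ k hk ih =>
    rw [H.succ k hk (by omega)]
    exact (((H.comm k l hk hkl hl).symm.mul_right (ih (by omega))).mul_right
      (H.comm_right k l hk hkl hl).symm)

lemma commute_lt (H : BraidStrand m T S x) {k l : ℕ} (hl : 1 ≤ l) (hlk : l + 1 < k)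
    (hk : k ≤ m) : Commute (T l) (x k) := by
  induction k, (show l + 2 ≤ k by omega) using Nat.le_induction with
  | base =>
    have hb := H.braid l hl (by omega)
    have hm := H.mixed l hl (by omega)
    have hx : T (l + 1) * x l = x l * T (l + 1) :=
      H.commute_gt hl (Nat.lt_succ_self l) (by omega)
    rw [H.succ (l + 1) (by omega) (by omega), H.succ l hl (by omega)]
    calc T l * (T (l + 1) * (T l * x l * S l) * S (l + 1))
        = (T l * T (l + 1) * T l) * x l * S l * S (l + 1) := by simp only [mul_assoc]
      _ = T (l + 1) * T l * (T (l + 1) * x l) * (S l * S (l + 1)) := by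
        rw [hb]; simp only [mul_assoc]
      _ = T (l + 1) * T l * x l * (T (l + 1) * (S l * S (l + 1))) := by
        rw [hx]; simp only [mul_assoc]
      _ = T (l + 1) * (T l * x l * S l) * S (l + 1) * T l := by
        rw [hm]; simp only [mul_assoc]
  | succ k hk' ih =>
    rw [H.succ k (by omega) (by omega)]
    exact ((H.comm l k hl (by omega) (by omega)).mul_right (ih (by omega) (by omega))).mul_right
      (H.comm_left l k hl (by omega) (by omega))

lemma commute_of_ne (H : BraidStrand m T S x) {k l : ℕ} (hl : 1 ≤ l) (hlm : l < m)
    (hk : 1 ≤ k) (hkm : k ≤ m) (h1 : k ≠ l) (h2 : k ≠ l + 1) : Commute (T l) (x k) := by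
  rcases lt_or_gt_of_ne h1 with h | h
  · exact H.commute_gt hk h hlm
  · exact H.commute_lt hl (by omega) hkm

/-- If the `T k` commute with an element beyond a given strand, so do the earlier strands. -/
lemma commute_of_commute (H : BraidStrand m T S x) {z : B} {l : ℕ} (hl : l ≤ m)
    (h1 : Commute (x 1) z) (hT : ∀ k, 1 ≤ k → k < l → Commute (T k) z)
    (hS : ∀ k, 1 ≤ k → k < l → Commute (S k) z) :
    ∀ k, 1 ≤ k → k ≤ l → Commute (x k) z := by
  intro k hk
  induction k, hk using Nat.le_induction with
  | base => exact fun _ => h1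
  | succ k hk ih =>
    intro hkl
    rw [H.succ k hk (by omega)]
    exact ((hT k hk (by omega)).mul_left (ih (by omega))).mul_left (hS k hk (by omega))

end BraidStrand

namespace HeckeSystem

variable {B : Type} [Ring B] [Algebra ℂ B] {q : ℂ} {m : ℕ} {T y : ℕ → B}

lemma braidStrand (H : HeckeSystem q m T y) : BraidStrand m T T y where
  braid := H.braid
  mixed k h1 h2 := by rw [← mul_assoc, ← H.braid k h1 h2]
  comm := H.comm
  comm_left := H.comm
  comm_right := H.comm
  base k _ _ := by rw [H.y_one]; exact Commute.one_right _
  succ k hk _ := H.y_succ k hk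

lemma y_comm (H : HeckeSystem q m T y) {k l : ℕ} (hk : 1 ≤ k) (hkm : k ≤ m)
    (hl : 1 ≤ l) (hlm : l ≤ m) : Commute (y k) (y l) := by
  wlog h : k < l generalizing k l
  · rcases (not_lt.mp h).eq_or_lt with rfl | h
    · exact Commute.refl _
    · exact (this hl hlm hk hkm h).symm
  have key : ∀ j, 1 ≤ j → j < k → Commute (T j) (y l) := fun j h1 h2 =>
    H.braidStrand.commute_lt h1 (by omega) hlm
  exact H.braidStrand.commute_of_commute hkm (by rw [H.y_one]; exact Commute.one_left _) key key
    k hk le_rfl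

lemma y_succ_mul_T (H : HeckeSystem q m T y) {k : ℕ} (hk : 1 ≤ k) (hkm : k < m) :
    y (k + 1) * T k = T k * y k + (q - q⁻¹) • y (k + 1) := by
  rw [H.y_succ k hk, mul_assoc (T k * y k), H.sq k hk hkm]
  simp only [mul_add, mul_smul_comm, mul_one]
  abel

lemma y_mul_T (H : HeckeSystem q m T y) {k : ℕ} (hk : 1 ≤ k) (hkm : k < m) :
    y k * T k = T k * y (k + 1) - (q - q⁻¹) • y (k + 1) := by
  have : T k * y (k + 1) = (q - q⁻¹) • y (k + 1) + y k * T k := by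
    rw [H.y_succ k hk, ← mul_assoc, ← mul_assoc, H.sq k hk hkm]
    simp only [add_mul, smul_mul_assoc, one_mul]
  rw [this]; abel

lemma y_mul_intertwiner (H : HeckeSystem q m T y) {k : ℕ} (hk : 1 ≤ k) (hkm : k < m) :
    y k * intertwiner q T y k = intertwiner q T y k * y (k + 1) := by
  have h1 := H.y_mul_T hk hkm
  have h2 := (H.y_comm hk hkm.le (Nat.succ_pos k) hkm).eq
  simp only [intertwiner, mul_add, add_mul, ← mul_assoc, h1, mul_sub, sub_mul, smul_mul_assoc,
    mul_smul_comm]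
  simp only [mul_assoc, h2]
  abel

lemma y_succ_mul_intertwiner (H : HeckeSystem q m T y) {k : ℕ} (hk : 1 ≤ k) (hkm : k < m) :
    y (k + 1) * intertwiner q T y k = intertwiner q T y k * y k := by
  have h1 := H.y_succ_mul_T hk hkm
  have h2 := (H.y_comm hk hkm.le (Nat.succ_pos k) hkm).eq
  simp only [intertwiner, mul_add, add_mul, ← mul_assoc, h1, mul_sub, sub_mul, smul_mul_assoc,
    mul_smul_comm]
  simp only [mul_assoc, h2]
  abel

lemma y_commute_intertwiner (H : HeckeSystem q m T y) {k j : ℕ} (hk : 1 ≤ k) (hkm : k < m)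
    (hj : 1 ≤ j) (hjm : j ≤ m) (h1 : j ≠ k) (h2 : j ≠ k + 1) :
    Commute (y j) (intertwiner q T y k) := by
  refine Commute.add_right (Commute.mul_right ?_ (Commute.sub_right ?_ ?_))
    (Commute.smul_right ?_ _)
  · exact (H.braidStrand.commute_of_ne hk hkm hj hjm h1 h2).symm
  · exact H.y_comm hj hjm hk hkm.le
  all_goals exact H.y_comm hj hjm (by omega) hkm

lemma intertwiner_sq (H : HeckeSystem q m T y) (hq : q ≠ 0) {k : ℕ} (hk : 1 ≤ k)
    (hkm : k < m) :
    intertwiner q T y k * intertwiner q T y k =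
      -((y (k + 1) - q ^ 2 • y k) * (y (k + 1) - (q ^ 2)⁻¹ • y k)) := by
  have h1 := H.y_mul_intertwiner hk hkm
  have h2 := H.y_succ_mul_intertwiner hk hkm
  have h3 := (H.y_comm hk hkm.le (Nat.succ_pos k) hkm).eq
  have h4 := H.sq k hk hkm
  have hT : T k * intertwiner q T y k
      = ((q - q⁻¹) • T k + 1) * (y k - y (k + 1)) + (q - q⁻¹) • (T k * y (k + 1)) := by
    rw [intertwiner, mul_add, ← mul_assoc, h4, mul_smul_comm]
  have hs : q ^ 2 + (q ^ 2)⁻¹ = 2 + (q - q⁻¹) * (q - q⁻¹) := by field_simp; ring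
  have hss : (q ^ 2)⁻¹ * q ^ 2 = 1 := inv_mul_cancel₀ (pow_ne_zero 2 hq)
  have hR : -((y (k + 1) - q ^ 2 • y k) * (y (k + 1) - (q ^ 2)⁻¹ • y k))
      = -(y (k + 1) * y (k + 1)) - y k * y k
        + ((2 : ℂ) + (q - q⁻¹) * (q - q⁻¹)) • (y k * y (k + 1)) := by
    rw [← hs]
    simp only [mul_sub, sub_mul, smul_mul_assoc, mul_smul_comm, smul_sub, smul_smul, hss, ← h3,
      add_smul, one_smul]
    module
  rw [hR]
  generalize hΘ : intertwiner q T y k = Θ at *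
  calc Θ * Θ = T k * Θ * (y (k + 1) - y k) + (q - q⁻¹) • (Θ * y k) := by
        nth_rewrite 1 [← hΘ]
        rw [intertwiner, add_mul, mul_assoc, sub_mul, h1, h2, ← mul_sub, ← mul_assoc,
          smul_mul_assoc, h2]
    _ = _ := by
        rw [hT, ← hΘ, intertwiner]
        simp only [mul_sub, sub_mul, add_mul, smul_mul_assoc, one_mul, mul_assoc, smul_add,
          smul_sub, ← h3]
        module

end HeckeSystem

/-! ### Weights -/

lemma NotRootOfUnity.zpow_ne_one {q : ℂ} (hq : NotRootOfUnity q) {k : ℤ} (hk : k ≠ 0) :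
    q ^ k ≠ 1 := by
  rcases lt_or_gt_of_ne hk with h | h
  · obtain ⟨n, hn⟩ := Int.eq_ofNat_of_zero_le (show 0 ≤ -k by omega)
    obtain rfl : k = -n := by omega
    intro h1
    rw [zpow_neg, inv_eq_one, zpow_natCast] at h1
    exact hq n (by omega) h1
  · obtain ⟨n, rfl⟩ := Int.eq_ofNat_of_zero_le h.le
    exact_mod_cast hq n (by omega)

/-- The eigenvalue of a Jucys–Murphy element belonging to the content `c`. -/
def contentWt (q : ℂ) (c : ℤ) : ℂ := q ^ (2 * c)

lemma contentWt_ne_zero {q : ℂ} (hq : q ≠ 0) (c : ℤ) : contentWt q c ≠ 0 := zpow_ne_zero _ hq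

lemma contentWt_injective {q : ℂ} (hq : q ≠ 0) (hq' : NotRootOfUnity q) :
    Function.Injective (contentWt q) := by
  intro c d h
  by_contra hne
  refine hq'.zpow_ne_one (show 2 * c - 2 * d ≠ 0 by omega) ?_
  rw [zpow_sub₀ hq]
  exact (div_eq_one_iff_eq (contentWt_ne_zero hq d)).mpr h

lemma contentWt_add_one {q : ℂ} (hq : q ≠ 0) (c : ℤ) :
    contentWt q (c + 1) = q ^ 2 * contentWt q c := by
  rw [contentWt, contentWt, mul_add, zpow_add₀ hq, mul_comm]; norm_cast

lemma contentWt_sub_one {q : ℂ} (hq : q ≠ 0) (c : ℤ) :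
    contentWt q (c - 1) = (q ^ 2)⁻¹ * contentWt q c := by
  rw [eq_inv_mul_iff_mul_eq₀ (pow_ne_zero 2 hq), ← contentWt_add_one hq, sub_add_cancel]

lemma sub_inv_ne_zero {q : ℂ} (hq : q ≠ 0) (hq' : NotRootOfUnity q) : q - q⁻¹ ≠ 0 := by
  intro h
  refine hq' 2 (by norm_num) ?_
  rw [sub_eq_zero] at h
  rw [pow_two]; nth_rewrite 2 [h]; exact mul_inv_cancel₀ hq

open Polynomial in
/-- The polynomial with simple roots at the weights of the contents in `S`. -/
def contentPoly (q : ℂ) (S : Finset ℤ) : ℂ[X] := ∏ b ∈ S, (X - C (contentWt q b))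

lemma eval_contentPoly_ne_zero {q : ℂ} (hq : q ≠ 0) (hq' : NotRootOfUnity q) {S : Finset ℤ}
    {b : ℤ} (hb : b ∉ S) : (contentPoly q S).eval (contentWt q b) ≠ 0 := by
  rw [contentPoly, Polynomial.eval_prod]
  refine Finset.prod_ne_zero_iff.mpr fun c hc => ?_
  simp only [Polynomial.eval_sub, Polynomial.eval_X, Polynomial.eval_C, sub_ne_zero]
  exact fun h => hb (contentWt_injective hq hq' h ▸ hc)

lemma eval_contentPoly_of_mem {q : ℂ} {S : Finset ℤ} {b : ℤ} (hb : b ∈ S) :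
    (contentPoly q S).eval (contentWt q b) = 0 := by
  rw [contentPoly, Polynomial.eval_prod]
  exact Finset.prod_eq_zero hb (by simp)

lemma contentPoly_insert (q : ℂ) {S : Finset ℤ} {b : ℤ} (hb : b ∉ S) :
    contentPoly q (insert b S) =
      (Polynomial.X - Polynomial.C (contentWt q b)) * contentPoly q S :=
  Finset.prod_insert hb

section Algebra

variable {B : Type} [Ring B] [Algebra ℂ B]

lemma aeval_mul_of_eigen {y x : B} {c : ℂ} (h : y * x = c • x) (p : Polynomial ℂ) :
    Polynomial.aeval y p * x = p.eval c • x := by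
  induction p using Polynomial.induction_on' with
  | add p r hp hr => simp [add_mul, hp, hr, add_smul]
  | monomial n r =>
    have : y ^ n * x = c ^ n • x := by
      induction n with
      | zero => simp
      | succ n ih => rw [pow_succ, mul_assoc, h, mul_smul_comm, ih, smul_smul, pow_succ']
    rw [Polynomial.aeval_monomial, mul_assoc, this, Polynomial.eval_monomial,
      ← Algebra.smul_def, smul_smul]

lemma mul_aeval_of_eigen {y x : B} {c : ℂ} (h : x * y = c • x) (p : Polynomial ℂ) :
    x * Polynomial.aeval y p = p.eval c • x := by
  induction p using Polynomial.induction_on' with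
  | add p r hp hr => simp [mul_add, hp, hr, add_smul]
  | monomial n r =>
    have : x * y ^ n = c ^ n • x := by
      induction n with
      | zero => simp
      | succ n ih => rw [pow_succ, ← mul_assoc, ih, smul_mul_assoc, h, smul_smul, pow_succ]
    rw [Polynomial.aeval_monomial, ← mul_assoc, ← Algebra.commutes, mul_assoc, this,
      Polynomial.eval_monomial, ← Algebra.smul_def, smul_smul]

/-- If `y` satisfies a polynomial with simple roots on an invariant subspace `V`, then a
subspace containing all eigenvectors in `V` contains `V`. -/
lemma eigenvector_induction {q : ℂ} (hq : q ≠ 0) (hq' : NotRootOfUnity q) {y : B}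
    (V N : Submodule ℂ B) (hV : ∀ x ∈ V, y * x ∈ V) (S : Finset ℤ)
    (hN : ∀ b ∈ S, ∀ u ∈ V, y * u = contentWt q b • u → u ∈ N) :
    ∀ x ∈ V, Polynomial.aeval y (contentPoly q S) * x = 0 → x ∈ N := by
  have hVp : ∀ (p : Polynomial ℂ), ∀ x ∈ V, Polynomial.aeval y p * x ∈ V := by
    intro p x hx
    induction p using Polynomial.induction_on' with
    | add p r hp hr => rw [map_add, add_mul]; exact V.add_mem hp hr
    | monomial n r =>
      rw [Polynomial.aeval_monomial, mul_assoc, ← Algebra.smul_def]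
      refine V.smul_mem _ ?_
      induction n with
      | zero => simpa
      | succ n ih => rw [pow_succ', mul_assoc]; exact hV _ ih
  induction S using Finset.induction_on with
  | empty =>
    intro x _ h
    simp only [contentPoly, Finset.prod_empty, map_one, one_mul] at h
    exact h ▸ N.zero_mem
  | insert b S hb ih =>
    intro x hx h
    set u := Polynomial.aeval y (contentPoly q S) * x with hu
    have huV : u ∈ V := hVp _ x hx
    have hyu : y * u = contentWt q b • u := by
      rw [contentPoly_insert q hb, map_mul, mul_assoc, ← hu] at h
      simp only [map_sub, Polynomial.aeval_X, Polynomial.aeval_C, sub_mul, sub_eq_zero] at h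
      rw [h, Algebra.smul_def]
    have huN := hN b (Finset.mem_insert_self b S) u huV hyu
    have hκ := eval_contentPoly_ne_zero hq hq' hb
    have := ih (fun c hc => hN c (Finset.mem_insert_of_mem hc))
      (x - ((contentPoly q S).eval (contentWt q b))⁻¹ • u)
      (V.sub_mem hx (V.smul_mem _ huV)) (by
        rw [mul_sub, mul_smul_comm, aeval_mul_of_eigen hyu, smul_smul, inv_mul_cancel₀ hκ,
          one_smul, ← hu, sub_self])
    have h2 := N.add_mem this (N.smul_mem ((contentPoly q S).eval (contentWt q b))⁻¹ huN)
    rwa [sub_add_cancel] at h2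

/-- The elements on which `y 1, …, y s` act on the left by the weights of `a 1, …, a s`. -/
def weightSpace (q : ℂ) (y : ℕ → B) (s : ℕ) (a : ℕ → ℤ) : Submodule ℂ B where
  carrier := {x | ∀ k, 1 ≤ k → k ≤ s → y k * x = contentWt q (a k) • x}
  add_mem' hx hy k h1 h2 := by rw [mul_add, hx k h1 h2, hy k h1 h2, smul_add]
  zero_mem' k _ _ := by simp
  smul_mem' c x hx k h1 h2 := by rw [mul_smul_comm, hx k h1 h2, smul_comm]

lemma mem_weightSpace {q : ℂ} {y : ℕ → B} {s : ℕ} {a : ℕ → ℤ} {x : B} :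
    x ∈ weightSpace q y s a ↔ ∀ k, 1 ≤ k → k ≤ s → y k * x = contentWt q (a k) • x := Iff.rfl

lemma weightSpace_mono {q : ℂ} {y : ℕ → B} {s t : ℕ} (h : t ≤ s) {a : ℕ → ℤ} {x : B}
    (hx : x ∈ weightSpace q y s a) : x ∈ weightSpace q y t a :=
  fun k h1 h2 => hx k h1 (h2.trans h)

lemma weightSpace_congr {q : ℂ} {y : ℕ → B} {s : ℕ} {a b : ℕ → ℤ}
    (h : ∀ k, 1 ≤ k → k ≤ s → a k = b k) {x : B}
    (hx : x ∈ weightSpace q y s a) : x ∈ weightSpace q y s b :=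
  fun k h1 h2 => h k h1 h2 ▸ hx k h1 h2

lemma commute_mul_mem_weightSpace {q : ℂ} {y : ℕ → B} {s : ℕ} {a : ℕ → ℤ} {x z : B}
    (hz : ∀ k, 1 ≤ k → k ≤ s → Commute z (y k)) (hx : x ∈ weightSpace q y s a) :
    z * x ∈ weightSpace q y s a := fun k h1 h2 => by
  rw [← mul_assoc, ← (hz k h1 h2).eq, mul_assoc, hx k h1 h2, mul_smul_comm]

lemma mem_weightSpace_update {q : ℂ} {y : ℕ → B} {s : ℕ} {a : ℕ → ℤ} {x : B} {b : ℤ}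
    (hx : x ∈ weightSpace q y s a) (hb : y (s + 1) * x = contentWt q b • x) :
    x ∈ weightSpace q y (s + 1) (Function.update a (s + 1) b) := by
  intro k h1 h2
  rcases eq_or_ne k (s + 1) with rfl | h
  · simpa using hb
  · rw [Function.update_of_ne h]; exact hx k h1 (by omega)

lemma intertwiner_mul {q : ℂ} {T y : ℕ → B} {k : ℕ} {x : B} {α β : ℂ}
    (h1 : y k * x = α • x) (h2 : y (k + 1) * x = β • x) :
    intertwiner q T y k * x = (α - β) • (T k * x) + ((q - q⁻¹) * β) • x := by
  rw [intertwiner, add_mul, mul_assoc, sub_mul, h1, h2, ← sub_smul, mul_smul_comm,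
    smul_mul_assoc, h2, smul_smul]

namespace HeckeSystem

variable {q : ℂ} {m : ℕ} {T y : ℕ → B}

lemma intertwiner_sq_mul (H : HeckeSystem q m T y) (hq : q ≠ 0) {k : ℕ} (hk : 1 ≤ k)
    (hkm : k < m) {x : B} {α β : ℂ} (h1 : y k * x = α • x) (h2 : y (k + 1) * x = β • x) :
    intertwiner q T y k * (intertwiner q T y k * x) =
      (-((β - q ^ 2 * α) * (β - (q ^ 2)⁻¹ * α))) • x := by
  rw [← mul_assoc, H.intertwiner_sq hq hk hkm, neg_mul, mul_assoc]
  simp only [sub_mul, smul_mul_assoc, h1, h2, smul_smul, ← sub_smul, mul_smul_comm, neg_smul]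
  congr 2; ring

lemma sq_coeff_ne_zero (hq : q ≠ 0) (hq' : NotRootOfUnity q) {c d : ℤ} (h : 2 ≤ |c - d|) :
    -((contentWt q d - q ^ 2 * contentWt q c) * (contentWt q d - (q ^ 2)⁻¹ * contentWt q c))
      ≠ 0 := by
  rw [← contentWt_add_one hq, ← contentWt_sub_one hq]
  refine neg_ne_zero.mpr (mul_ne_zero ?_ ?_) <;> rw [sub_ne_zero] <;> intro e <;>
    have := contentWt_injective hq hq' e <;> subst this <;> simp at h

lemma intertwiner_mul_mem (H : HeckeSystem q m T y) {k N : ℕ} {a : ℕ → ℤ} {x : B}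
    (hk : 1 ≤ k) (hkN : k + 1 ≤ N) (hN : N ≤ m) (hx : x ∈ weightSpace q y N a) :
    intertwiner q T y k * x ∈ weightSpace q y N (a ∘ Equiv.swap k (k + 1)) := by
  intro j h1 h2
  simp only [Function.comp_apply]
  rcases eq_or_ne j k with rfl | hjk
  · rw [← mul_assoc, H.y_mul_intertwiner hk (by omega), mul_assoc, hx _ (by omega) hkN,
      mul_smul_comm, Equiv.swap_apply_left]
  rcases eq_or_ne j (k + 1) with rfl | hjk'
  · rw [← mul_assoc, H.y_succ_mul_intertwiner hk (by omega), mul_assoc, hx _ hk (by omega),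
      mul_smul_comm, Equiv.swap_apply_right]
  · rw [← mul_assoc, (H.y_commute_intertwiner hk (by omega) h1 (by omega) hjk hjk').eq,
      mul_assoc, hx j h1 h2, mul_smul_comm, Equiv.swap_apply_of_ne_of_ne hjk hjk']

lemma exists_ne_zero_of_swap (H : HeckeSystem q m T y) (hq : q ≠ 0) (hq' : NotRootOfUnity q)
    {r N : ℕ} (hr : r ≤ N) (hN : N ≤ m) {a b : ℕ → ℤ} (h : AdmSwap r a b)
    (ha : ∃ x ∈ weightSpace q y N a, x ≠ 0) : ∃ x ∈ weightSpace q y N b, x ≠ 0 := by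
  obtain ⟨k, h1, h2, h3, rfl⟩ := h
  obtain ⟨x, hx, hne⟩ := ha
  refine ⟨_, H.intertwiner_mul_mem h1 (h2.trans hr) hN hx, fun h0 => ?_⟩
  have := H.intertwiner_sq_mul hq h1 (by omega) (hx k h1 (by omega)) (hx (k + 1) (by omega)
    (by omega))
  rw [h0, mul_zero] at this
  exact hne ((smul_eq_zero.mp this.symm).resolve_left (sq_coeff_ne_zero hq hq' h3))

lemma exists_ne_zero_of_reach (H : HeckeSystem q m T y) (hq : q ≠ 0) (hq' : NotRootOfUnity q)
    {r N : ℕ} (hr : r ≤ N) (hN : N ≤ m) {a b : ℕ → ℤ} (h : AdmReach r a b)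
    (ha : ∃ x ∈ weightSpace q y N a, x ≠ 0) : ∃ x ∈ weightSpace q y N b, x ≠ 0 := by
  induction h with
  | refl => exact ha
  | tail _ h ih => exact H.exists_ne_zero_of_swap hq hq' hr hN h ih

/-- Neighbouring Jucys–Murphy elements have no common eigenvalue where the first of them is
semisimple. -/
lemma eq_zero_of_weight_eq (H : HeckeSystem q m T y) (hq : q ≠ 0) (hq' : NotRootOfUnity q)
    {k : ℕ} (hk : 1 ≤ k) (hkm : k < m) {S : Finset ℤ} {x : B} {c : ℤ}
    (hT : Polynomial.aeval (y k) (contentPoly q S) * (T k * x) = 0)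
    (hS : Polynomial.aeval (y k) (contentPoly q S) * x = 0)
    (h1 : y k * x = contentWt q c • x) (h2 : y (k + 1) * x = contentWt q c • x) : x = 0 := by
  by_cases hc : c ∈ S
  · rw [← Finset.insert_erase hc, contentPoly_insert q (Finset.notMem_erase c S), mul_comm,
      map_mul, mul_assoc] at hT
    have h3 : Polynomial.aeval (y k) (Polynomial.X - Polynomial.C (contentWt q c)) * (T k * x)
        = (-((q - q⁻¹) * contentWt q c)) • x := by
      simp only [map_sub, Polynomial.aeval_X, Polynomial.aeval_C, sub_mul]
      rw [← mul_assoc, H.y_mul_T hk hkm, sub_mul, mul_assoc, h2, smul_mul_assoc, h2,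
        ← Algebra.smul_def, mul_smul_comm, smul_smul, neg_smul]
      module
    rw [h3, mul_smul_comm, aeval_mul_of_eigen h1] at hT
    have hκ := eval_contentPoly_ne_zero hq hq' (Finset.notMem_erase c S)
    have h4 : -((q - q⁻¹) * contentWt q c) ≠ 0 :=
      neg_ne_zero.mpr (mul_ne_zero (sub_inv_ne_zero hq hq') (contentWt_ne_zero hq c))
    exact (smul_eq_zero.mp ((smul_eq_zero.mp hT).resolve_left h4)).resolve_left hκ
  · rw [aeval_mul_of_eigen h1] at hS
    exact (smul_eq_zero.mp hS).resolve_left (eval_contentPoly_ne_zero hq hq' hc)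

/-- The braid relation excludes simultaneous eigenvectors of `T k` and `T (k + 1)` of weights
`α, β, α`. -/
lemma eq_zero_of_intertwiner_eq_zero (H : HeckeSystem q m T y) {k : ℕ}
    (hk : 1 ≤ k) (hkm : k + 1 < m) {x : B} {α β : ℂ} (hh : q - q⁻¹ ≠ 0)
    (hα : α ≠ 0) (hβ : β ≠ 0) (hne : α - β ≠ 0) (hne' : α + β ≠ 0)
    (h1 : y k * x = α • x) (h2 : y (k + 1) * x = β • x) (h3 : y (k + 2) * x = α • x)
    (h4 : intertwiner q T y k * x = 0) (h5 : intertwiner q T y (k + 1) * x = 0) : x = 0 := by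
  rw [intertwiner_mul h1 h2] at h4
  rw [intertwiner_mul h2 h3] at h5
  have hT : T k * x = (-((q - q⁻¹) * β) / (α - β)) • x := by
    rw [div_eq_inv_mul, ← smul_smul, neg_smul, ← eq_neg_of_add_eq_zero_left h4, smul_smul,
      inv_mul_cancel₀ hne, one_smul]
  have hU : T (k + 1) * x = (((q - q⁻¹) * α) / (α - β)) • x := by
    have : (β - α) • (T (k + 1) * x) = -(((q - q⁻¹) * α) • x) := eq_neg_of_add_eq_zero_left h5
    rw [← neg_sub α β, neg_smul, neg_inj] at this
    rw [div_eq_inv_mul, ← smul_smul, ← this, smul_smul, inv_mul_cancel₀ hne, one_smul]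
  have hb := congrArg (· * x) (H.braid k hk hkm)
  simp only [mul_assoc, hT, hU, mul_smul_comm, smul_smul] at hb
  rw [← sub_eq_zero, ← sub_smul] at hb
  refine (smul_eq_zero.mp hb).resolve_left ?_
  have : -((q - q⁻¹) * β) / (α - β) * ((q - q⁻¹) * α / (α - β) * (-((q - q⁻¹) * β) / (α - β))) -
      (q - q⁻¹) * α / (α - β) * (-((q - q⁻¹) * β) / (α - β) * ((q - q⁻¹) * α / (α - β))) =
      (q - q⁻¹) ^ 3 * α * β * (α + β) / (α - β) ^ 3 := by
    field_simp; ring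
  rw [this]
  positivity

end HeckeSystem

end Algebra

section Algebra

variable {B : Type} [Ring B] [Algebra ℂ B]

lemma mul_aeval_of_semiconj {z y y' : B} (h : z * y = y' * z) (p : Polynomial ℂ) :
    z * Polynomial.aeval y p = Polynomial.aeval y' p * z := by
  induction p using Polynomial.induction_on' with
  | add p r hp hr => rw [map_add, map_add, mul_add, add_mul, hp, hr]
  | monomial n r =>
    rw [Polynomial.aeval_monomial, Polynomial.aeval_monomial, ← mul_assoc,
      ← Algebra.commutes r z, mul_assoc, mul_assoc, (SemiconjBy.pow_right h n).eq]

/-- On the weight spaces of `y 1, …, y s` the next element is semisimple, and its eigenvalues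
are the weights of contents of addable boxes. -/
def SplitsAt (q : ℂ) (y : ℕ → B) (s : ℕ) : Prop :=
  ∀ a : ℕ → ℤ, ∃ S : Finset ℤ, (∀ b ∈ S, LocMin (profile a s) b) ∧
    ∀ x ∈ weightSpace q y s a, Polynomial.aeval (y (s + 1)) (contentPoly q S) * x = 0

lemma isContentSeq_of_ne_zero {q : ℂ} (hq : q ≠ 0) (hq' : NotRootOfUnity q) {y : ℕ → B}
    {s : ℕ} (D : ∀ t < s, SplitsAt q y t) {a : ℕ → ℤ} {x : B} (hx : x ∈ weightSpace q y s a)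
    (hne : x ≠ 0) : IsContentSeq a s := by
  intro k hk
  obtain ⟨S, hS, hSx⟩ := D k hk a
  refine hS _ ?_
  by_contra hmem
  have := hSx x (weightSpace_mono hk.le hx)
  rw [aeval_mul_of_eigen (hx (k + 1) (by omega) hk)] at this
  exact hne ((smul_eq_zero.mp this).resolve_left (eval_contentPoly_ne_zero hq hq' hmem))

namespace HeckeSystem

variable {q : ℂ} {m : ℕ} {T y : ℕ → B}

lemma eq_zero_of_mem_weightSpace (H : HeckeSystem q m T y) (hq : q ≠ 0)
    (hq' : NotRootOfUnity q) {t : ℕ} (D : SplitsAt q y t) (ht : t + 2 ≤ m) {a : ℕ → ℤ}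
    {x : B} (hx : x ∈ weightSpace q y (t + 2) a) (h : a (t + 1) = a (t + 2)) : x = 0 := by
  obtain ⟨S, -, hS⟩ := D a
  have hx' := weightSpace_mono (show t ≤ t + 2 by omega) hx
  refine H.eq_zero_of_weight_eq hq hq' (k := t + 1) (by omega) (by omega)
    (hS _ (commute_mul_mem_weightSpace (fun k h1 h2 => ?_) hx')) (hS _ hx')
    (hx _ (by omega) (by omega)) (h ▸ hx _ (by omega) le_rfl)
  exact H.braidStrand.commute_gt h1 (by omega) (by omega)

lemma eq_zero_of_locMax (H : HeckeSystem q m T y) (hq : q ≠ 0)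
    (hq' : NotRootOfUnity q) {s : ℕ} (hs : s + 2 ≤ m) (D : ∀ t ≤ s, SplitsAt q y t)
    {a : ℕ → ℤ} {u : B} (hu : u ∈ weightSpace q y (s + 2) a)
    (hadj : a (s + 2) = a (s + 1) + 1 ∨ a (s + 2) = a (s + 1) - 1)
    (hmax : LocMax (profile a s) (a (s + 2))) : u = 0 := by
  by_contra hne
  have hcs : IsContentSeq a s := isContentSeq_of_ne_zero hq hq' (fun t ht => D t ht.le)
    (weightSpace_mono (by omega) hu) hne
  obtain ⟨hs1, b, hreach, hb⟩ := hcs.exists_reach_last hmax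
  obtain ⟨v, hv, hv0⟩ := H.exists_ne_zero_of_reach hq hq' (show s ≤ s + 2 by omega) hs hreach
    ⟨u, hu, hne⟩
  obtain ⟨r, rfl⟩ : ∃ r, s = r + 1 := ⟨s - 1, by omega⟩
  have e1 : b (r + 1 + 1) = a (r + 1 + 1) := hreach.apply_of_gt (by omega)
  have e2 : b (r + 1 + 2) = a (r + 1 + 2) := hreach.apply_of_gt (by omega)
  have h4 : intertwiner q T y (r + 1) * v = 0 := by
    have := H.intertwiner_mul_mem (k := r + 1) (by omega) (by omega) hs hv
    refine H.eq_zero_of_mem_weightSpace hq hq' (D (r + 1) le_rfl) hs this ?_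
    simp only [Function.comp_apply]
    rw [Equiv.swap_apply_right, Equiv.swap_apply_of_ne_of_ne (by omega) (by omega), hb, e2]
  have h5 : intertwiner q T y (r + 1 + 1) * v = 0 := by
    have := H.intertwiner_mul_mem (k := r + 1 + 1) (by omega) (by omega) hs hv
    refine H.eq_zero_of_mem_weightSpace hq hq' (D r (by omega)) (by omega)
      (weightSpace_mono (show r + 2 ≤ r + 1 + 2 by omega) this) ?_
    simp only [Function.comp_apply]
    rw [Equiv.swap_apply_left, Equiv.swap_apply_of_ne_of_ne (by omega) (by omega), hb, e2]
  have hwt : ∀ c d : ℤ, (c = d + 1 ∨ c = d - 1) →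
      contentWt q c - contentWt q d ≠ 0 ∧ contentWt q c + contentWt q d ≠ 0 := by
    intro c d hcd
    refine ⟨sub_ne_zero.mpr fun h => ?_, fun h => ?_⟩
    · have := contentWt_injective hq hq' h; omega
    · have h2 : (contentWt q c) ^ 2 = (contentWt q d) ^ 2 := by
        rw [eq_neg_of_add_eq_zero_left h, neg_sq]
      rw [contentWt, contentWt, ← zpow_natCast, ← zpow_natCast, ← zpow_mul, ← zpow_mul] at h2
      refine hq'.zpow_ne_one (show 2 * c * (2 : ℕ) - 2 * d * (2 : ℕ) ≠ 0 by omega) ?_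
      rw [zpow_sub₀ hq, h2, div_self (zpow_ne_zero _ hq)]
  obtain ⟨n1, n2⟩ := hwt _ _ hadj
  refine hv0 (H.eq_zero_of_intertwiner_eq_zero (k := r + 1) (by omega) (by omega)
    (sub_inv_ne_zero hq hq') (contentWt_ne_zero hq (a (r + 1 + 2)))
    (contentWt_ne_zero hq (a (r + 1 + 1))) n1 n2 ?_ ?_ ?_ h4 h5)
  · rw [← hb]; exact hv _ (by omega) (by omega)
  · rw [← e1]; exact hv _ (by omega) (by omega)
  · rw [← e2]; exact hv _ (by omega) (by omega)

lemma splitsAt_zero (H : HeckeSystem q m T y) : SplitsAt q y 0 := by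
  refine fun a => ⟨{0}, fun b hb => ?_, fun x _ => ?_⟩
  · rw [Finset.mem_singleton] at hb
    simp [hb, LocMin, profile]
  · simp [contentPoly, contentWt, H.y_one]

lemma splitsAt_succ (H : HeckeSystem q m T y) (hq : q ≠ 0) (hq' : NotRootOfUnity q) {s : ℕ}
    (hs : s + 2 ≤ m) (D : ∀ t ≤ s, SplitsAt q y t) : SplitsAt q y (s + 1) := by
  intro a
  by_cases hex : ∃ x ∈ weightSpace q y (s + 1) a, x ≠ 0
  swap
  · push Not at hex
    exact ⟨∅, by simp, fun x hx => by rw [hex x hx, mul_zero]⟩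
  obtain ⟨x₀, hx₀, hne₀⟩ := hex
  have hcs : IsContentSeq a (s + 1) :=
    isContentSeq_of_ne_zero hq hq' (fun t ht => D t (by omega)) hx₀ hne₀
  obtain ⟨S, hS, hSx⟩ := D s le_rfl a
  have hc := hcs s (by omega)
  set c := a (s + 1) with hcdef
  have n1 : c + 1 ∉ insert (c - 1) S := by
    rw [Finset.mem_insert, not_or]
    refine ⟨by omega, fun h => ?_⟩
    have h1 := (hS _ h).1
    rw [add_sub_cancel_right] at h1
    have := hc.2
    omega
  have n2 : c - 1 ∉ S := fun h => by
    have h1 := (hS _ h).2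
    rw [sub_add_cancel] at h1
    have := hc.1
    omega
  have hS1 : ∀ x ∈ weightSpace q y (s + 1) a, Polynomial.aeval (y (s + 1 + 1))
      (contentPoly q (insert (c + 1) (insert (c - 1) S))) * x = 0 := by
    intro x hx
    have hyx := hx (s + 1) (by omega) le_rfl
    have hyy := (H.y_comm (show 1 ≤ s + 1 by omega) (by omega) (show 1 ≤ s + 1 + 1 by omega)
      (by omega)).eq
    have hθ := hSx _ (commute_mul_mem_weightSpace (z := intertwiner q T y (s + 1))
      (fun k h1 h2 => (H.y_commute_intertwiner (by omega) (by omega) h1 (by omega) (by omega)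
        (by omega)).symm) (weightSpace_mono (by omega : s ≤ s + 1) hx))
    have hsq : intertwiner q T y (s + 1) * (intertwiner q T y (s + 1) * x) =
        -((y (s + 1 + 1) - algebraMap ℂ B (contentWt q (c + 1))) *
          ((y (s + 1 + 1) - algebraMap ℂ B (contentWt q (c - 1))) * x)) := by
      rw [← mul_assoc, H.intertwiner_sq hq (by omega) (by omega), neg_mul, mul_assoc,
        contentWt_add_one hq, contentWt_sub_one hq]
      have hyyx : y (s + 1) * (y (s + 1 + 1) * x) =
          contentWt q (a (s + 1)) • (y (s + 1 + 1) * x) := by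
        rw [← mul_assoc, hyy, mul_assoc, hyx, mul_smul_comm]
      simp only [sub_mul, mul_sub, smul_mul_assoc, mul_smul_comm, ← Algebra.smul_def,
        hyx, hyyx, smul_smul, hcdef]
    have key := congrArg (intertwiner q T y (s + 1) * ·) hθ
    simp only [mul_zero] at key
    rw [← mul_assoc, mul_aeval_of_semiconj (H.y_succ_mul_intertwiner (by omega) (by omega)).symm,
      mul_assoc, hsq, mul_neg, neg_eq_zero] at key
    rw [contentPoly_insert q n1, contentPoly_insert q n2, ← mul_assoc, mul_comm, map_mul,
      map_mul]
    simpa [mul_assoc] using key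
  refine ⟨(insert (c + 1) (insert (c - 1) S)).filter (LocMin (profile a (s + 1))),
    fun b hb => (Finset.mem_filter.mp hb).2, fun x hx => ?_⟩
  refine eigenvector_induction hq hq' (weightSpace q y (s + 1) a)
    (LinearMap.ker (LinearMap.mulLeft ℂ (Polynomial.aeval (y (s + 1 + 1)) (contentPoly q
      ((insert (c + 1) (insert (c - 1) S)).filter (LocMin (profile a (s + 1))))))))
    (fun x hx => commute_mul_mem_weightSpace (fun k h1 h2 => H.y_comm (by omega) (by omega) h1
      (by omega)) hx) (insert (c + 1) (insert (c - 1) S)) ?_ x hx (hS1 x hx)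
  intro b hb u hu hbu
  rw [LinearMap.mem_ker, LinearMap.mulLeft_apply]
  by_cases hmin : LocMin (profile a (s + 1)) b
  · rw [aeval_mul_of_eigen hbu, eval_contentPoly_of_mem (Finset.mem_filter.mpr ⟨hb, hmin⟩),
      zero_smul]
  have hu2 := mem_weightSpace_update hu hbu
  have e0 : ∀ k ≤ s + 1, Function.update a (s + 1 + 1) b k = a k :=
    fun k hk => Function.update_of_ne (by omega) _ _
  have e1 : Function.update a (s + 1 + 1) b (s + 1 + 1) = b := Function.update_self _ _ _
  suffices u = 0 by rw [this, mul_zero]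
  rcases eq_or_ne b c with hbc | hbc
  · refine H.eq_zero_of_mem_weightSpace hq hq' (D s le_rfl) hs hu2 ?_
    rw [e0 _ le_rfl, e1, ← hcdef, hbc]
  have hadj : b = c + 1 ∨ b = c - 1 := by
    simp only [Finset.mem_insert] at hb
    rcases hb with h | h | h
    · exact Or.inl h
    · exact Or.inr h
    · exact absurd (LocMin.succ_of_ne hc (hS b h) hbc) hmin
  refine H.eq_zero_of_locMax hq hq' hs D hu2 (by rwa [e0 _ le_rfl, e1]) ?_
  rw [e1, profile_congr (b := a) fun k _ h => e0 k (by omega)]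
  exact (locMin_or_locMax_of_adj hcs hadj).resolve_left hmin

theorem splitsAt (H : HeckeSystem q m T y) (hq : q ≠ 0) (hq' : NotRootOfUnity q) (s : ℕ)
    (hs : s + 1 ≤ m) : SplitsAt q y s := by
  induction s using Nat.strong_induction_on with
  | _ s ih =>
    cases s with
    | zero => exact H.splitsAt_zero
    | succ s => exact H.splitsAt_succ hq hq' hs fun t ht => ih t (by omega) (by omega)

end HeckeSystem

end Algebra

lemma IsContentSeq.profile_eq_abs {a : ℕ → ℤ} {s : ℕ} (h : IsContentSeq a s) {d : ℤ}
    (hd : s ≤ |d|) : profile a s d = |d| := by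
  induction s generalizing d with
  | zero => rfl
  | succ s ih =>
    have h' : (s : ℤ) ≤ |d| := by push_cast at hd; omega
    rw [profile, ih h.of_succ h', add_eq_left, if_neg]
    rintro rfl
    have hl := h s (by omega)
    rcases le_or_gt 0 (a (s + 1)) with h0 | h0
    · have h1 := hl.1
      rw [abs_of_nonneg h0] at hd
      rw [ih h.of_succ h', ih h.of_succ (by rw [abs_of_nonneg] <;> omega), abs_of_nonneg h0,
        abs_of_nonneg (by omega)] at h1
      omega
    · have h1 := hl.2
      rw [abs_of_neg h0] at hd
      rw [ih h.of_succ h', ih h.of_succ (by rw [abs_of_nonpos] <;> omega), abs_of_neg h0,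
        abs_of_nonpos (by omega)] at h1
      omega

lemma IsContentSeq.abs_le {a : ℕ → ℤ} {s : ℕ} (h : IsContentSeq a s) {b : ℤ}
    (hb : LocMin (profile a s) b) : |b| ≤ s := by
  by_contra! hlt
  rcases le_or_gt 0 b with h0 | h0
  · have h1 := hb.1
    rw [abs_of_nonneg h0] at hlt
    rw [h.profile_eq_abs (by rw [abs_of_nonneg] <;> omega),
      h.profile_eq_abs (by rw [abs_of_nonneg] <;> omega), abs_of_nonneg h0,
      abs_of_nonneg (by omega)] at h1
    omega
  · have h1 := hb.2
    rw [abs_of_neg h0] at hlt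
    rw [h.profile_eq_abs (by rw [abs_of_nonpos] <;> omega),
      h.profile_eq_abs (by rw [abs_of_nonpos] <;> omega), abs_of_neg h0,
      abs_of_nonpos (by omega)] at h1
    omega

section Algebra

variable {B : Type} [Ring B] [Algebra ℂ B]

/-- The subalgebra generated by `T 1, …, T (r - 1)`. -/
def strandAlg (T : ℕ → B) (r : ℕ) : Subalgebra ℂ B := Algebra.adjoin ℂ (T '' Set.Ico 1 r)

lemma mem_strandAlg {T : ℕ → B} {r k : ℕ} (hk : 1 ≤ k) (hkr : k < r) : T k ∈ strandAlg T r :=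
  Algebra.subset_adjoin ⟨k, ⟨hk, hkr⟩, rfl⟩

lemma strandAlg_mono {T : ℕ → B} {r s : ℕ} (h : r ≤ s) : strandAlg T r ≤ strandAlg T s :=
  Algebra.adjoin_mono (Set.image_mono (Set.Ico_subset_Ico_right h))

lemma strandAlg_eq_bot {T : ℕ → B} {r : ℕ} (h : r ≤ 1) : strandAlg T r = ⊥ := by
  rw [strandAlg, Set.Ico_eq_empty (by omega), Set.image_empty, Algebra.adjoin_empty]

lemma commute_of_mem_strandAlg {T : ℕ → B} {r : ℕ} {z u : B}
    (h : ∀ k, 1 ≤ k → k < r → Commute (T k) z) (hu : u ∈ strandAlg T r) : Commute u z := by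
  induction hu using Algebra.adjoin_induction with
  | mem x hx => obtain ⟨k, hk, rfl⟩ := hx; exact h k hk.1 hk.2
  | algebraMap c => exact Algebra.commute_algebraMap_left c z
  | add x y _ _ hx hy => exact hx.add_left hy
  | mul x y _ _ hx hy => exact hx.mul_left hy

namespace HeckeSystem

variable {q : ℂ} {m : ℕ} {T y : ℕ → B}

/-- An operator vanishing on all weight vectors vanishes. -/
lemma eq_zero_of_forall_mul_eq_zero (H : HeckeSystem q m T y) (hq : q ≠ 0)
    (hq' : NotRootOfUnity q) {s : ℕ} (hs : s ≤ m) {z : B}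
    (hz : ∀ a, ∀ w ∈ weightSpace q y s a, z * w = 0) : z = 0 := by
  induction s with
  | zero => rw [← mul_one z]; exact hz 0 1 fun k h1 h2 => by omega
  | succ s ih =>
    refine ih (by omega) fun a w hw => ?_
    obtain ⟨S, -, hS⟩ := H.splitsAt hq hq' s hs a
    refine eigenvector_induction hq hq' (weightSpace q y s a)
      (LinearMap.ker (LinearMap.mulLeft ℂ z))
      (fun x hx => commute_mul_mem_weightSpace (fun k h1 h2 => H.y_comm (by omega) (by omega) h1
        (by omega)) hx) S ?_ w hw (hS w hw)
    intro b _ u hu hbu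
    exact hz _ u (mem_weightSpace_update hu hbu)

lemma exists_aeval_eq_zero (H : HeckeSystem q m T y) (hq : q ≠ 0)
    (hq' : NotRootOfUnity q) {r : ℕ} (hr : 1 ≤ r) (hrm : r ≤ m) :
    ∃ S : Finset ℤ, Polynomial.aeval (y r) (contentPoly q S) = 0 := by
  obtain ⟨s, rfl⟩ : ∃ s, r = s + 1 := ⟨r - 1, by omega⟩
  refine ⟨Finset.Icc (-s) s, H.eq_zero_of_forall_mul_eq_zero hq hq' (show s ≤ m by omega)
    fun a w hw => ?_⟩
  by_cases hw0 : w = 0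
  · rw [hw0, mul_zero]
  have hcs : IsContentSeq a s :=
    isContentSeq_of_ne_zero hq hq' (fun t ht => H.splitsAt hq hq' t (by omega)) hw hw0
  obtain ⟨S, hS, hSw⟩ := H.splitsAt hq hq' s hrm a
  have hsub : S ⊆ Finset.Icc (-s : ℤ) s := fun b hb => by
    have := abs_le.mp (hcs.abs_le (hS b hb))
    exact Finset.mem_Icc.mpr this
  rw [contentPoly, ← Finset.prod_sdiff hsub, map_mul, mul_assoc]
  change _ * (Polynomial.aeval (y (s + 1)) (contentPoly q S) * w) = 0
  rw [hSw w hw, mul_zero]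

lemma y_mem_strandAlg (H : HeckeSystem q m T y) {r : ℕ} (hr : 1 ≤ r) : y r ∈ strandAlg T r := by
  induction r, hr using Nat.le_induction with
  | base => rw [H.y_one]; exact one_mem _
  | succ r hr ih =>
    rw [H.y_succ r hr]
    have hT := mem_strandAlg (T := T) hr (Nat.lt_succ_self r)
    exact mul_mem (mul_mem hT (strandAlg_mono (Nat.le_succ r) ih)) hT

/-- The two-sided decomposition of the next Hecke algebra over the previous one. -/
lemma strandAlg_succ_induction (H : HeckeSystem q m T y) {r : ℕ} (hr : 1 ≤ r) (hrm : r < m)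
    (N : Submodule ℂ B) (h0 : ∀ u ∈ strandAlg T r, u ∈ N)
    (h1 : ∀ u ∈ strandAlg T r, ∀ v ∈ strandAlg T r, u * T r * v ∈ N) :
    ∀ u ∈ strandAlg T (r + 1), u ∈ N := by
  induction r, hr using Nat.le_induction generalizing N with
  | base =>
    have key : ∀ u ∈ strandAlg T (1 + 1), ∃ c d : ℂ, u = c • 1 + d • T 1 := by
      intro u hu
      induction hu using Algebra.adjoin_induction with
      | mem x hx =>
        obtain ⟨k, ⟨hk, hk'⟩, rfl⟩ := hx
        obtain rfl : k = 1 := by omega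
        exact ⟨0, 1, by simp⟩
      | algebraMap c => exact ⟨c, 0, by rw [zero_smul, add_zero, Algebra.algebraMap_eq_smul_one]⟩
      | add x z _ _ hx hz =>
        obtain ⟨c, d, rfl⟩ := hx
        obtain ⟨c', d', rfl⟩ := hz
        exact ⟨c + c', d + d', by module⟩
      | mul x z _ _ hx hz =>
        obtain ⟨c, d, rfl⟩ := hx
        obtain ⟨c', d', rfl⟩ := hz
        refine ⟨c * c' + d * d', c * d' + d * c' + d * d' * (q - q⁻¹), ?_⟩
        simp only [add_mul, mul_add, smul_mul_smul_comm, one_mul, mul_one, H.sq 1 le_rfl hrm]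
        module
    intro u hu
    obtain ⟨c, d, rfl⟩ := key u hu
    have := h1 1 (one_mem _) 1 (one_mem _)
    rw [one_mul, mul_one] at this
    exact N.add_mem (N.smul_mem c (h0 1 (one_mem _))) (N.smul_mem d this)
  | succ r hr ih =>
    set A := strandAlg T (r + 1) with hA
    let M : Submodule ℂ B := Subalgebra.toSubmodule A ⊔
      Submodule.span ℂ {x | ∃ u ∈ A, ∃ v ∈ A, x = u * T (r + 1) * v}
    have hM0 : ∀ u ∈ A, u ∈ M := fun u hu => Submodule.mem_sup_left hu
    have hM1 : ∀ u ∈ A, ∀ v ∈ A, u * T (r + 1) * v ∈ M := fun u hu v hv =>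
      Submodule.mem_sup_right (Submodule.subset_span ⟨u, hu, v, hv, rfl⟩)
    have hMN : M ≤ N := by
      refine sup_le h0 (Submodule.span_le.mpr ?_)
      rintro x ⟨u, hu, v, hv, rfl⟩
      exact h1 u hu v hv
    have hM : ∀ (f : B →ₗ[ℂ] B), (∀ u ∈ A, f u ∈ M) →
        (∀ u ∈ A, ∀ v ∈ A, f (u * T (r + 1) * v) ∈ M) → ∀ x ∈ M, f x ∈ M := by
      intro f hf0 hf1
      change M ≤ M.comap f
      refine sup_le hf0 (Submodule.span_le.mpr ?_)
      rintro x ⟨u, hu, v, hv, rfl⟩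
      exact hf1 u hu v hv
    have hright : ∀ w ∈ A, ∀ x ∈ M, x * w ∈ M := fun w hw =>
      hM (LinearMap.mulRight ℂ w) (fun u hu => hM0 _ (mul_mem hu hw))
        fun u hu v hv => by
          rw [LinearMap.mulRight_apply, mul_assoc]; exact hM1 u hu _ (mul_mem hv hw)
    have hleft : ∀ w ∈ A, ∀ x ∈ M, w * x ∈ M := fun w hw =>
      hM (LinearMap.mulLeft ℂ w) (fun u hu => hM0 _ (mul_mem hw hu))
        fun u hu v hv => by
          rw [LinearMap.mulLeft_apply, ← mul_assoc, ← mul_assoc]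
          exact hM1 _ (mul_mem hw hu) v hv
    have hcomm : ∀ u ∈ strandAlg T r, Commute u (T (r + 1)) := fun u hu =>
      commute_of_mem_strandAlg (fun k h1 h2 => H.comm k (r + 1) h1 (by omega) hrm) hu
    have hTT : ∀ u ∈ A, T (r + 1) * u * T (r + 1) ∈ M := by
      refine ih (by omega) (M.comap ((LinearMap.mulRight ℂ (T (r + 1))) ∘ₗ
        (LinearMap.mulLeft ℂ (T (r + 1))))) ?_ ?_
      · intro u hu
        have hu' := strandAlg_mono (Nat.le_succ r) hu
        simp only [Submodule.mem_comap, LinearMap.comp_apply, LinearMap.mulLeft_apply,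
          LinearMap.mulRight_apply]
        rw [← (hcomm u hu).eq, mul_assoc, H.sq _ (by omega) hrm, mul_add, mul_one, mul_smul_comm]
        refine M.add_mem (M.smul_mem _ ?_) (hM0 u hu')
        rw [← mul_one (u * _)]
        exact hM1 u hu' 1 (one_mem _)
      · intro u hu v hv
        have hu' := strandAlg_mono (Nat.le_succ r) hu
        have hv' := strandAlg_mono (Nat.le_succ r) hv
        have hT := mem_strandAlg (T := T) hr (Nat.lt_succ_self r)
        simp only [Submodule.mem_comap, LinearMap.comp_apply, LinearMap.mulLeft_apply,
          LinearMap.mulRight_apply]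
        have : T (r + 1) * (u * T r * v) * T (r + 1) =
            (u * T r) * T (r + 1) * (T r * v) := by
          calc T (r + 1) * (u * T r * v) * T (r + 1)
              = (T (r + 1) * u) * T r * (v * T (r + 1)) := by simp only [mul_assoc]
            _ = u * (T (r + 1) * T r * T (r + 1)) * v := by
              rw [← (hcomm u hu).eq, (hcomm v hv).eq]; simp only [mul_assoc]
            _ = _ := by rw [← H.braid r hr hrm]; simp only [mul_assoc]
        rw [this]
        exact hM1 _ (mul_mem hu' hT) _ (mul_mem hT hv')
    have hstep : ∀ u ∈ strandAlg T (r + 1 + 1), ∀ x ∈ M, u * x ∈ M := by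
      intro u hu
      induction hu using Algebra.adjoin_induction with
      | mem x hx =>
        obtain ⟨k, ⟨hk, hk'⟩, rfl⟩ := hx
        rcases (show k ≤ r + 1 by omega).lt_or_eq with hlt | rfl
        · exact hleft _ (mem_strandAlg hk hlt)
        · refine hM (LinearMap.mulLeft ℂ (T (r + 1))) (fun u hu => ?_) fun u hu v hv => ?_
          · rw [LinearMap.mulLeft_apply, ← one_mul (T (r + 1))]
            exact hM1 1 (one_mem _) u hu
          · rw [LinearMap.mulLeft_apply, ← mul_assoc, ← mul_assoc]
            exact hright v hv _ (hTT u hu)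
      | algebraMap c =>
        intro x hx
        rw [← Algebra.smul_def]
        exact M.smul_mem c hx
      | add x z _ _ hx hz => intro w hw; rw [add_mul]; exact M.add_mem (hx w hw) (hz w hw)
      | mul x z _ _ hx hz => intro w hw; rw [mul_assoc]; exact hx _ (hz w hw)
    intro u hu
    have := hstep u hu 1 (hM0 1 (one_mem _))
    rw [mul_one] at this
    exact hMN this

/-- The corner of the Hecke algebra between weight vectors of equal weights is one-dimensional. -/
lemma mul_mul_mem_span (H : HeckeSystem q m T y) (hq : q ≠ 0) (hq' : NotRootOfUnity q) {r : ℕ}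
    (hrm : r ≤ m) {a : ℕ → ℤ} {x x' : B} (hx : x ∈ weightSpace q y r a)
    (hx' : ∀ k, 1 ≤ k → k ≤ r → x' * y k = contentWt q (a k) • x') :
    ∀ u ∈ strandAlg T r, x' * u * x ∈ Submodule.span ℂ {x' * x} := by
  induction r with
  | zero =>
    intro u hu
    rw [strandAlg_eq_bot (by omega)] at hu
    obtain ⟨c, rfl⟩ := Algebra.mem_bot.mp hu
    rw [← Algebra.commutes, mul_assoc, ← Algebra.smul_def]
    exact Submodule.smul_mem _ c (Submodule.mem_span_singleton_self _)
  | succ r ih =>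
    have IH := ih (by omega) (weightSpace_mono (Nat.le_succ r) hx)
      fun k h1 h2 => hx' k h1 (by omega)
    rcases Nat.eq_zero_or_pos r with rfl | hr
    · intro u hu
      refine IH u ?_
      rwa [strandAlg_eq_bot (by omega)] at hu ⊢
    refine H.strandAlg_succ_induction hr hrm ((Submodule.span ℂ {x' * x}).comap
      (LinearMap.mulRight ℂ x ∘ₗ LinearMap.mulLeft ℂ x')) (fun u hu => IH u hu) ?_
    intro u hu v hv
    have hcomm : ∀ w ∈ strandAlg T r, Commute w (y (r + 1)) := fun w hw =>
      commute_of_mem_strandAlg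
        (fun k h1 h2 => H.braidStrand.commute_lt h1 (by omega) hrm) hw
    obtain ⟨S, hS⟩ := H.exists_aeval_eq_zero hq hq' hr (by omega : r ≤ m)
    refine eigenvector_induction hq hq' (Subalgebra.toSubmodule (strandAlg T r))
      ((Submodule.span ℂ {x' * x}).comap (LinearMap.mulRight ℂ x ∘ₗ LinearMap.mulLeft ℂ x' ∘ₗ
        LinearMap.mulLeft ℂ (u * T r)))
      (fun w hw => (strandAlg T r).mul_mem (H.y_mem_strandAlg hr) hw) S ?_ v hv
      (by rw [hS, zero_mul])
    intro b _ w hw hbw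
    simp only [Submodule.mem_comap, LinearMap.comp_apply, LinearMap.mulLeft_apply,
      LinearMap.mulRight_apply]
    have h1 : y r * (w * x) = contentWt q b • (w * x) := by
      rw [← mul_assoc, hbw, smul_mul_assoc]
    have h2 : y (r + 1) * (w * x) = contentWt q (a (r + 1)) • (w * x) := by
      rw [← mul_assoc, ← (hcomm w hw).eq, mul_assoc, hx _ (by omega) le_rfl, mul_smul_comm]
    rcases eq_or_ne b (a (r + 1)) with rfl | hne
    · have := H.eq_zero_of_weight_eq hq hq' hr hrm (S := S) (by rw [hS, zero_mul])
        (by rw [hS, zero_mul]) h1 h2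
      rw [mul_assoc x', mul_assoc (u * T r), this]
      simp
    have hβγ : contentWt q b - contentWt q (a (r + 1)) ≠ 0 :=
      sub_ne_zero.mpr fun h => hne (contentWt_injective hq hq' h)
    have h3 : x' * u * (intertwiner q T y r * (w * x)) = 0 := by
      have e1 : x' * u * (y (r + 1) * (intertwiner q T y r * (w * x))) =
          contentWt q (a (r + 1)) • (x' * u * (intertwiner q T y r * (w * x))) := by
        rw [← mul_assoc, mul_assoc x', (hcomm u hu).eq, ← mul_assoc x', hx' _ (by omega) le_rfl,
          smul_mul_assoc, smul_mul_assoc]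
      rw [← mul_assoc (y (r + 1)), H.y_succ_mul_intertwiner hr hrm, mul_assoc (intertwiner q T y r),
        h1, mul_smul_comm, mul_smul_comm, ← sub_eq_zero, ← sub_smul] at e1
      exact (smul_eq_zero.mp e1).resolve_left hβγ
    rw [intertwiner_mul h1 h2, mul_add, mul_smul_comm, mul_smul_comm] at h3
    have h4 := eq_neg_of_add_eq_zero_left h3
    have h5 : x' * (u * T r * w) * x = x' * u * (T r * (w * x)) := by simp only [mul_assoc]
    have h6 : x' * u * (w * x) = x' * (u * w) * x := by simp only [mul_assoc]
    rw [h5, ← one_smul ℂ (x' * u * (T r * (w * x))), ← inv_mul_cancel₀ hβγ, ← smul_smul, h4, h6]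
    exact Submodule.smul_mem _ _ (Submodule.neg_mem _ (Submodule.smul_mem _ _
      (IH _ (mul_mem hu hw))))

end HeckeSystem

end Algebra

section Algebra

variable {B : Type} [Ring B] [Algebra ℂ B]

/-- The primitive idempotents with the weights of the sequence `a`. -/
structure IsWeightIdem (q : ℂ) (m : ℕ) (y : ℕ → B) (a : ℕ → ℤ) (e : B) : Prop where
  ne_zero : e ≠ 0
  idem : e * e = e
  left : e ∈ weightSpace q y m a
  right : ∀ k, 1 ≤ k → k ≤ m → e * y k = contentWt q (a k) • e

lemma IsWeightIdem.congr {q : ℂ} {m : ℕ} {y : ℕ → B} {a b : ℕ → ℤ} {e : B}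
    (h : IsWeightIdem q m y a e) (hab : ∀ k, 1 ≤ k → k ≤ m → a k = b k) :
    IsWeightIdem q m y b e :=
  ⟨h.ne_zero, h.idem, weightSpace_congr hab h.left, fun k h1 h2 => hab k h1 h2 ▸ h.right k h1 h2⟩

namespace HeckeSystem

variable {q : ℂ} {m : ℕ} {T y : ℕ → B}

/-- A polynomial in the Jucys–Murphy elements which projects onto the weight of `a`. -/
lemma exists_projector (H : HeckeSystem q m T y) (hq : q ≠ 0) (hq' : NotRootOfUnity q)
    {a : ℕ → ℤ} (ha : ∃ x ∈ weightSpace q y m a, x ≠ 0) {s : ℕ} (hs : s ≤ m) :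
    ∃ p : B, (∀ k, 1 ≤ k → k ≤ m → Commute (y k) p) ∧ p ∈ weightSpace q y s a ∧
      ∃ κ : ℂ, κ ≠ 0 ∧ (∀ f ∈ weightSpace q y s a, p * f = κ • f) ∧
        ∀ f, (∀ k, 1 ≤ k → k ≤ s → f * y k = contentWt q (a k) • f) → f * p = κ • f := by
  induction s with
  | zero =>
    exact ⟨1, fun _ _ _ => Commute.one_right _, fun k h1 h2 => by omega, 1, one_ne_zero,
      fun f _ => by simp, fun f _ => by simp⟩
  | succ s ih =>
    obtain ⟨p, hp, hpw, κ, hκ, hl, hr⟩ := ih (by omega)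
    obtain ⟨x, hx, hx0⟩ := ha
    obtain ⟨S, hS⟩ := H.exists_aeval_eq_zero hq hq' (r := s + 1) (by omega) hs
    have hmem : a (s + 1) ∈ S := by
      by_contra hmem
      have := aeval_mul_of_eigen (hx (s + 1) (by omega) hs) (contentPoly q S)
      rw [hS, zero_mul] at this
      exact hx0 ((smul_eq_zero.mp this.symm).resolve_left (eval_contentPoly_ne_zero hq hq' hmem))
    set Q := contentPoly q (S.erase (a (s + 1))) with hQ
    have hy : ∀ k, 1 ≤ k → k ≤ m → Commute (y k) (Polynomial.aeval (y (s + 1)) Q) :=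
      fun k h1 h2 => mul_aeval_of_semiconj (H.y_comm h1 h2 (by omega) hs).eq Q
    refine ⟨p * Polynomial.aeval (y (s + 1)) Q, fun k h1 h2 => (hp k h1 h2).mul_right (hy k h1 h2),
      fun k h1 h2 => ?_, κ * Q.eval (contentWt q (a (s + 1))),
      mul_ne_zero hκ (eval_contentPoly_ne_zero hq hq' (Finset.notMem_erase _ _)),
      fun f hf => ?_, fun f hf => ?_⟩
    · rcases h2.lt_or_eq with hlt | rfl
      · rw [← mul_assoc, hpw k h1 (by omega), smul_mul_assoc]
      · have : (y (s + 1) - algebraMap ℂ B (contentWt q (a (s + 1)))) *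
            Polynomial.aeval (y (s + 1)) Q = 0 := by
          rw [← hS, ← Finset.insert_erase hmem, contentPoly_insert q (Finset.notMem_erase _ _),
            map_mul]
          simp [hQ]
        rw [sub_mul, sub_eq_zero, ← Algebra.smul_def] at this
        rw [← mul_assoc, (hp _ (by omega) hs).eq, mul_assoc, this, mul_smul_comm]
    · rw [mul_assoc, aeval_mul_of_eigen (hf (s + 1) (by omega) le_rfl), mul_smul_comm,
        hl f (weightSpace_mono (Nat.le_succ s) hf), smul_smul, mul_comm]
    · rw [← mul_assoc, hr f fun k h1 h2 => hf k h1 (by omega), smul_mul_assoc,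
        mul_aeval_of_eigen (hf (s + 1) (by omega) le_rfl), smul_smul]

/-- The primitive idempotent of a given weight is unique. -/
lemma weightIdem_unique (H : HeckeSystem q m T y) (hgen : strandAlg T m = ⊤) (hq : q ≠ 0)
    (hq' : NotRootOfUnity q) {a : ℕ → ℤ} {e e' : B} (he : IsWeightIdem q m y a e)
    (he' : IsWeightIdem q m y a e') : e = e' := by
  obtain ⟨p, hp, hpw, κ, hκ, hl, hr⟩ :=
    H.exists_projector hq hq' ⟨e, he.left, he.ne_zero⟩ le_rfl
  have hpp : p * p = κ • p := hl p hpw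
  have hpr : ∀ k, 1 ≤ k → k ≤ m → p * y k = contentWt q (a k) • p := fun k h1 h2 => by
    rw [← (hp k h1 h2).eq, hpw k h1 h2]
  have key : ∀ f, IsWeightIdem q m y a f → f = κ⁻¹ • p := by
    intro f hf
    obtain ⟨c, hc⟩ := Submodule.mem_span_singleton.mp
      (H.mul_mul_mem_span hq hq' le_rfl hpw hpr f (hgen ▸ Algebra.mem_top))
    rw [hl f hf.left, smul_mul_assoc, hr f hf.right, hpp, smul_smul, smul_smul] at hc
    have hfc : f = ((κ * κ)⁻¹ * (c * κ)) • p := by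
      rw [← smul_smul, hc, smul_smul, inv_mul_cancel₀ (mul_ne_zero hκ hκ), one_smul]
    generalize (κ * κ)⁻¹ * (c * κ) = d at hfc
    have hd : d ≠ 0 := fun h => hf.ne_zero (by rw [hfc, h, zero_smul])
    have hp0 : p ≠ 0 := fun h => hf.ne_zero (by rw [hfc, h, smul_zero])
    have hidem := hf.idem
    rw [hfc, smul_mul_smul_comm, hpp, smul_smul, ← sub_eq_zero, ← sub_smul] at hidem
    have h0 := (smul_eq_zero.mp hidem).resolve_right hp0
    have : d = κ⁻¹ := by
      have h1 : d * (d * κ - 1) = 0 := by linear_combination h0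
      exact eq_inv_of_mul_eq_one_left (sub_eq_zero.mp ((mul_eq_zero.mp h1).resolve_left hd))
    rw [hfc, this]
  rw [key e he, key e' he']

lemma mul_intertwiner_right (H : HeckeSystem q m T y) {k : ℕ} {a : ℕ → ℤ} {x : B}
    (hk : 1 ≤ k) (hkm : k + 1 ≤ m) (hx : ∀ j, 1 ≤ j → j ≤ m → x * y j = contentWt q (a j) • x)
    {j : ℕ} (h1 : 1 ≤ j) (h2 : j ≤ m) :
    x * intertwiner q T y k * y j =
      contentWt q ((a ∘ Equiv.swap k (k + 1)) j) • (x * intertwiner q T y k) := by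
  simp only [Function.comp_apply]
  rcases eq_or_ne j k with rfl | hjk
  · rw [mul_assoc, ← H.y_succ_mul_intertwiner hk (by omega), ← mul_assoc, hx _ (by omega) hkm,
      smul_mul_assoc, Equiv.swap_apply_left]
  rcases eq_or_ne j (k + 1) with rfl | hjk'
  · rw [mul_assoc, ← H.y_mul_intertwiner hk (by omega), ← mul_assoc, hx _ hk (by omega),
      smul_mul_assoc, Equiv.swap_apply_right]
  · rw [mul_assoc, ← (H.y_commute_intertwiner hk (by omega) h1 (by omega) hjk hjk').eq,
      ← mul_assoc, hx j h1 h2, smul_mul_assoc, Equiv.swap_apply_of_ne_of_ne hjk hjk']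

variable {A : Type} [AddCommGroup A] [Module ℂ A]

/-- Admissible transpositions conjugate the primitive idempotents, up to a central trace. -/
lemma exists_weightIdem_of_swap (H : HeckeSystem q m T y) (hq : q ≠ 0) (hq' : NotRootOfUnity q)
    (χ : B →ₗ[ℂ] A) (hχ : ∀ u v, χ (u * v) = χ (v * u)) {a b : ℕ → ℤ} (h : AdmSwap m a b) {e : B}
    (he : IsWeightIdem q m y a e) : ∃ f, IsWeightIdem q m y b f ∧ χ f = χ e := by
  obtain ⟨k, h1, h2, h3, rfl⟩ := h
  have hκ := sq_coeff_ne_zero hq hq' h3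
  have hsq := H.intertwiner_sq_mul hq h1 (by omega) (he.left k h1 (by omega))
    (he.left (k + 1) (by omega) h2)
  revert hκ hsq
  generalize -((contentWt q (a (k + 1)) - q ^ 2 * contentWt q (a k)) *
    (contentWt q (a (k + 1)) - (q ^ 2)⁻¹ * contentWt q (a k))) = κ
  intro hκ hsq
  set Θ := intertwiner q T y k
  have hmid : e * Θ * (Θ * e) = κ • e := by rw [mul_assoc, hsq, mul_smul_comm, he.idem]
  refine ⟨κ⁻¹ • (Θ * e * Θ), ⟨?_, ?_, ?_, ?_⟩, ?_⟩
  · intro h0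
    have h0' := (smul_eq_zero.mp h0).resolve_left (inv_ne_zero hκ)
    have : e * Θ * (Θ * e * Θ) * (Θ * e) = (κ * κ) • e := by
      rw [← mul_assoc (e * Θ), hmid, smul_mul_assoc, smul_mul_assoc, hmid, smul_smul]
    rw [h0', mul_zero, zero_mul] at this
    exact he.ne_zero ((smul_eq_zero.mp this.symm).resolve_left (mul_ne_zero hκ hκ))
  · have : Θ * e * Θ * (Θ * e * Θ) = κ • (Θ * e * Θ) := by
      rw [mul_assoc Θ e Θ, mul_assoc Θ (e * Θ), ← mul_assoc Θ e Θ, ← mul_assoc (e * Θ), hmid,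
        smul_mul_assoc, mul_smul_comm, mul_assoc]
    rw [smul_mul_smul_comm, this, smul_smul, mul_assoc, inv_mul_cancel₀ hκ, mul_one]
  · intro j hj hjm
    have := H.intertwiner_mul_mem h1 h2 le_rfl he.left j hj hjm
    rw [mul_smul_comm, ← mul_assoc, this, smul_mul_assoc, smul_comm]
  · intro j hj hjm
    have := H.mul_intertwiner_right h1 h2 he.right hj hjm
    rw [smul_mul_assoc, mul_assoc Θ, mul_assoc Θ, this, mul_smul_comm, smul_comm]
  · rw [map_smul, hχ, hsq, map_smul, smul_smul, inv_mul_cancel₀ hκ, one_smul]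

lemma exists_reach (H : HeckeSystem q m T y) (hq : q ≠ 0) (hq' : NotRootOfUnity q) {r : ℕ}
    (hr : r ≤ m) {a b : ℕ → ℤ} (ha : ∃ x ∈ weightSpace q y m a, x ≠ 0) (hb : IsContentSeq b r)
    (hab : profile a r = profile b r) :
    ∃ c, AdmReach r a c ∧ ∀ k, 1 ≤ k → k ≤ r → c k = b k := by
  induction r generalizing a with
  | zero => exact ⟨a, .refl, fun k h1 h2 => by omega⟩
  | succ r ih =>
    have hcs : IsContentSeq a (r + 1) := by
      obtain ⟨x, hx, hx0⟩ := ha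
      exact isContentSeq_of_ne_zero hq hq' (fun t ht => H.splitsAt hq hq' t (by omega))
        (weightSpace_mono hr hx) hx0
    have hmax := locMax_profile_succ (hb r (by omega))
    rw [← hab] at hmax
    obtain ⟨-, c, hc, hcr⟩ := hcs.exists_reach_last hmax
    have hprof : profile c r = profile b r := by
      funext d
      have := congrFun (hc.profile_eq.trans hab) d
      simpa only [profile, hcr, add_left_inj] using this
    obtain ⟨d, hd, hdb⟩ := ih (by omega) (H.exists_ne_zero_of_reach hq hq' hr le_rfl hc ha)
      hb.of_succ hprof
    refine ⟨d, Relation.ReflTransGen.trans hc (hd.mono (Nat.le_succ r)), fun k h1 h2 => ?_⟩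
    rcases h2.lt_or_eq with h | rfl
    · exact hdb k h1 (by omega)
    · rw [hd.apply_of_gt (Nat.lt_succ_self r), hcr]

/-- A central trace takes equal values on primitive idempotents whose content sequences have the
same shape. -/
theorem trace_weightIdem_eq (H : HeckeSystem q m T y) (hgen : strandAlg T m = ⊤) (hq : q ≠ 0)
    (hq' : NotRootOfUnity q) (χ : B →ₗ[ℂ] A) (hχ : ∀ u v, χ (u * v) = χ (v * u)) {a b : ℕ → ℤ}
    (hab : profile a m = profile b m) {e f : B} (he : IsWeightIdem q m y a e)
    (hf : IsWeightIdem q m y b f) : χ e = χ f := by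
  have hb : IsContentSeq b m :=
    isContentSeq_of_ne_zero hq hq' (fun t ht => H.splitsAt hq hq' t ht) hf.left hf.ne_zero
  obtain ⟨c, hc, hcb⟩ := H.exists_reach hq hq' le_rfl ⟨e, he.left, he.ne_zero⟩ hb hab
  obtain ⟨g, hg, hge⟩ : ∃ g, IsWeightIdem q m y c g ∧ χ g = χ e := by
    clear hcb
    induction hc with
    | refl => exact ⟨e, he, rfl⟩
    | tail _ h ih =>
      obtain ⟨g, hg, hge⟩ := ih
      obtain ⟨g', hg', hge'⟩ := H.exists_weightIdem_of_swap hq hq' χ hχ h hg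
      exact ⟨g', hg', hge'.trans hge⟩
  rw [← hge, H.weightIdem_unique hgen hq hq' (hg.congr hcb) hf]

end HeckeSystem

end Algebra

/-! ### The Hecke algebra and tableaux -/

lemma Tp_eq (q : ℂ) (m : ℕ) {k : ℕ} (hk : 1 ≤ k) (hkm : k < m) :
    Tp q m k = Tgen q m ⟨k - 1, by omega⟩ := dif_pos _

lemma heckeSystem {q : ℂ} (hq : q ≠ 0) (m : ℕ) : HeckeSystem q m (Tp q m) (yJM q m) where
  sq k h1 h2 := by
    have := RingQuot.mkAlgHom_rel ℂ (HeckeRel.quad (q := q) (m := m) ⟨k - 1, by omega⟩)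
    simp only [map_mul, map_sub, map_add, AlgHom.commutes, map_zero, sub_mul, mul_add] at this
    rw [Tp_eq q m h1 h2]
    change Tgen q m ⟨k - 1, _⟩ * Tgen q m ⟨k - 1, _⟩ - _ * Tgen q m ⟨k - 1, _⟩ +
      (Tgen q m ⟨k - 1, _⟩ * _ - _) = 0 at this
    rw [← Algebra.commutes, ← map_mul, mul_inv_cancel₀ hq, map_one, ← Algebra.smul_def,
      ← Algebra.smul_def] at this
    rw [← sub_eq_zero, ← this]
    module
  braid k h1 h2 := by
    have := RingQuot.mkAlgHom_rel ℂ (HeckeRel.braid (q := q) (m := m) ⟨k - 1, by omega⟩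
      ⟨k + 1 - 1, by omega⟩ (by simp only; omega))
    simp only [map_mul] at this
    rw [Tp_eq q m h1 (by omega), Tp_eq q m (by omega) h2]
    exact this
  comm k l h1 h2 h3 := by
    have := RingQuot.mkAlgHom_rel ℂ (HeckeRel.commute (q := q) (m := m) ⟨k - 1, by omega⟩
      ⟨l - 1, by omega⟩ (by simp only; omega))
    simp only [map_mul] at this
    rw [Tp_eq q m h1 (by omega), Tp_eq q m (by omega) h3]
    exact this
  y_one := rfl
  y_succ k hk := by
    obtain ⟨l, rfl⟩ : ∃ l, k = l + 1 := ⟨k - 1, by omega⟩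
    rfl

lemma strandAlg_Tp_eq_top (q : ℂ) (m : ℕ) : strandAlg (Tp q m) m = ⊤ := by
  rw [eq_top_iff]
  rintro x -
  obtain ⟨f, rfl⟩ := RingQuot.mkAlgHom_surjective ℂ (HeckeRel q m) x
  induction f using FreeAlgebra.induction with
  | grade0 c => rw [AlgHom.commutes]; exact Subalgebra.algebraMap_mem _ c
  | grade1 i =>
    have : Tp q m (i + 1) = RingQuot.mkAlgHom ℂ (HeckeRel q m) (FreeAlgebra.ι ℂ i) :=
      Tp_eq q m (by omega) (by omega)
    rw [← this]
    exact mem_strandAlg (by omega) (by omega)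
  | mul a b ha hb => rw [map_mul]; exact mul_mem ha hb
  | add a b ha hb => rw [map_add]; exact add_mem ha hb

lemma profile_ctnAt {μ : YoungDiagram} {m : ℕ} (U : StdTab μ m) (d : ℤ) :
    profile (ctnAt U) m d = |d| + ∑ c ∈ μ.cells, if ctn c = d then 2 else 0 := by
  rw [profile_eq_sum]
  congr 1
  refine Finset.sum_nbij U.pos (fun k hk => ?_) ?_ ?_ fun k _ => rfl
  · exact U.bij.mapsTo (by simpa using hk)
  · simpa using U.bij.injOn
  · simpa using U.bij.surjOn

lemma IsJMIdem.isWeightIdem {q : ℂ} {m : ℕ} {μ : YoungDiagram} {U : StdTab μ m} {e : Hecke q m}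
    (h : IsJMIdem q m U e) : IsWeightIdem q m (yJM q m) (ctnAt U) e :=
  ⟨h.1, h.2.1, fun k h1 h2 => (h.2.2 k h1 h2).1, fun k h1 h2 => (h.2.2 k h1 h2).2⟩

/-- A central trace on the Hecke algebra takes equal values on the primitive idempotents of
tableaux of the same shape. -/
theorem trace_jmIdem_eq {A : Type} [AddCommGroup A] [Module ℂ A] {q : ℂ} (hq : q ≠ 0)
    (hq' : NotRootOfUnity q) {m : ℕ} (χ : Hecke q m →ₗ[ℂ] A) (hχ : ∀ u v, χ (u * v) = χ (v * u))
    {μ : YoungDiagram} {U U' : StdTab μ m} {e e' : Hecke q m} (he : IsJMIdem q m U e)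
    (he' : IsJMIdem q m U' e') : χ e = χ e' :=
  (heckeSystem hq m).trace_weightIdem_eq (strandAlg_Tp_eq_top q m) hq hq' χ hχ
    (funext fun d => by rw [profile_ctnAt, profile_ctnAt]) he.isWeightIdem he'.isWeightIdem

/-! ### Reflection systems -/

section Reflection

variable {B : Type} [Ring B] [Algebra ℂ B] {q : ℂ} {m : ℕ} {T y X : ℕ → B}

/-- The inverses `T k - (q - q⁻¹)` of the Hecke generators. -/
def heckeInv (q : ℂ) (T : ℕ → B) (k : ℕ) : B := T k - (q - q⁻¹) • 1

/-- The inverses of the Jucys–Murphy elements. -/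
def jmInv (q : ℂ) (T : ℕ → B) : ℕ → B
  | 0 => 1
  | 1 => 1
  | k + 2 => heckeInv q T (k + 1) * jmInv q T (k + 1) * heckeInv q T (k + 1)

lemma commute_heckeInv {k : ℕ} {z : B} (h : Commute (T k) z) : Commute (heckeInv q T k) z :=
  h.sub_left ((Commute.one_left z).smul_left _)

lemma commute_of_heckeInv {k : ℕ} {z : B} (h : Commute (heckeInv q T k) z) : Commute (T k) z := by
  rw [← sub_add_cancel (T k) ((q - q⁻¹) • 1)]
  exact h.add_left ((Commute.one_left z).smul_left _)

lemma jmInv_succ {k : ℕ} (hk : 1 ≤ k) :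
    jmInv q T (k + 1) = heckeInv q T k * jmInv q T k * heckeInv q T k := by
  obtain ⟨l, rfl⟩ : ∃ l, k = l + 1 := ⟨k - 1, by omega⟩
  rfl

namespace HeckeSystem

lemma mul_heckeInv (H : HeckeSystem q m T y) {k : ℕ} (hk : 1 ≤ k) (hkm : k < m) :
    T k * heckeInv q T k = 1 := by
  rw [heckeInv, mul_sub, H.sq k hk hkm, mul_smul_comm, mul_one, add_sub_cancel_left]

lemma heckeInv_mul (H : HeckeSystem q m T y) {k : ℕ} (hk : 1 ≤ k) (hkm : k < m) :
    heckeInv q T k * T k = 1 := by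
  rw [heckeInv, sub_mul, H.sq k hk hkm, smul_mul_assoc, one_mul, add_sub_cancel_left]

lemma heckeInv_sq (H : HeckeSystem q m T y) {k : ℕ} (hk : 1 ≤ k) (hkm : k < m) :
    heckeInv q T k * heckeInv q T k = 1 - (q - q⁻¹) • heckeInv q T k := by
  nth_rewrite 1 [heckeInv]
  rw [sub_mul, H.mul_heckeInv hk hkm, smul_mul_assoc, one_mul]

lemma heckeInv_braid (H : HeckeSystem q m T y) {k : ℕ} (hk : 1 ≤ k) (hkm : k + 1 < m) :
    heckeInv q T k * heckeInv q T (k + 1) * heckeInv q T k =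
      heckeInv q T (k + 1) * heckeInv q T k * heckeInv q T (k + 1) := by
  have a1 := H.mul_heckeInv hk (by omega)
  have a2 := H.heckeInv_mul hk (by omega)
  have b1 := H.mul_heckeInv (Nat.succ_pos k) hkm
  have b2 := H.heckeInv_mul (Nat.succ_pos k) hkm
  have hb := H.braid k hk hkm
  generalize heckeInv q T k = s at *
  generalize heckeInv q T (k + 1) = s' at *
  refine left_inv_eq_right_inv (a := T k * T (k + 1) * T k) ?_ ?_
  · rw [show s * s' * s * (T k * T (k + 1) * T k) = s * (s' * (s * T k) * T (k + 1)) * T k by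
      simp only [mul_assoc], a2, mul_one, b2, mul_one, a2]
  · rw [hb, show T (k + 1) * T k * T (k + 1) * (s' * s * s') =
      T (k + 1) * (T k * (T (k + 1) * s') * s) * s' by simp only [mul_assoc], b1, mul_one, a1,
      mul_one, b1]

lemma inverse (H : HeckeSystem q m T y) : HeckeSystem q⁻¹ m (heckeInv q T) (jmInv q T) where
  sq k h1 h2 := by
    rw [H.heckeInv_sq h1 h2, inv_inv]
    module
  braid k h1 h2 := H.heckeInv_braid h1 h2
  comm k l h1 h2 h3 := commute_heckeInv (commute_heckeInv (H.comm k l h1 h2 h3).symm).symm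
  y_one := rfl
  y_succ k hk := jmInv_succ hk

lemma jmInv_mul (H : HeckeSystem q m T y) {k : ℕ} (hk : 1 ≤ k) (hkm : k ≤ m) :
    jmInv q T k * y k = 1 := by
  induction k, hk using Nat.le_induction with
  | base => rw [H.y_one]; exact mul_one 1
  | succ k hk ih =>
    rw [H.y_succ k hk, jmInv_succ hk]
    calc heckeInv q T k * jmInv q T k * heckeInv q T k * (T k * y k * T k)
        = heckeInv q T k * (jmInv q T k * (heckeInv q T k * T k) * y k) * T k := by
          simp only [mul_assoc]
      _ = 1 := by
        rw [H.heckeInv_mul hk hkm, mul_one, ih (by omega), mul_one, H.heckeInv_mul hk hkm]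

lemma jmInv_mul_of_mem (H : HeckeSystem q m T y) (hq : q ≠ 0) {a : ℕ → ℤ} {E : B}
    (hE : E ∈ weightSpace q y m a) {k : ℕ} (hk : 1 ≤ k) (hkm : k ≤ m) :
    jmInv q T k * E = q ^ (-2 * a k) • E := by
  have h1 := mem_weightSpace.mp hE k hk hkm
  have h2 : E = q ^ (-2 * a k) • (y k * E) := by
    rw [h1, smul_smul, contentWt, ← zpow_add₀ hq, neg_mul, neg_add_cancel, zpow_zero, one_smul]
  nth_rewrite 1 [h2]
  rw [mul_smul_comm, ← mul_assoc, H.jmInv_mul hk hkm, one_mul]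

end HeckeSystem

/-- A Hecke system with elements `X 1, …, X m` where `X 1` solves the reflection equation and
`X (k + 1)` is the conjugate of `X k` by `T k`. -/
structure ReflectionSystem (q : ℂ) (m : ℕ) (T y X : ℕ → B) : Prop where
  hecke : HeckeSystem q m T y
  base : ∀ k, 2 ≤ k → k < m → Commute (T k) (X 1)
  succ : ∀ k, 1 ≤ k → k < m → X (k + 1) = T k * X k * heckeInv q T k
  refl_one : 1 < m → T 1 * X 1 * T 1 * X 1 = X 1 * T 1 * X 1 * T 1

namespace ReflectionSystem

lemma braidStrand (H : ReflectionSystem q m T y X) : BraidStrand m T (heckeInv q T) X where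
  braid := H.hecke.braid
  mixed k h1 h2 := by
    have a1 := H.hecke.mul_heckeInv h1 (by omega)
    have a2 := H.hecke.heckeInv_mul h1 (by omega)
    have b1 := H.hecke.mul_heckeInv (Nat.succ_pos k) h2
    have b2 := H.hecke.heckeInv_mul (Nat.succ_pos k) h2
    have hb := H.hecke.braid k h1 h2
    generalize heckeInv q T k = s at *
    generalize heckeInv q T (k + 1) = s' at *
    calc T (k + 1) * (s * s')
        = s * (s' * T (k + 1)) * T k * T (k + 1) * s * s' := by
          rw [b2, mul_one, a2, one_mul, mul_assoc]
      _ = s * s' * (T (k + 1) * T k * T (k + 1)) * s * s' := by simp only [mul_assoc]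
      _ = s * s' * T k * (T (k + 1) * (T k * s) * s') := by rw [← hb]; simp only [mul_assoc]
      _ = s * s' * T k := by rw [a1, mul_one, b1, mul_one]
  comm := H.hecke.comm
  comm_left k l h1 h2 h3 := (commute_heckeInv (H.hecke.comm k l h1 h2 h3).symm).symm
  comm_right k l h1 h2 h3 := commute_heckeInv (H.hecke.comm k l h1 h2 h3)
  base := H.base
  succ := H.succ

lemma reflection (H : ReflectionSystem q m T y X) {k : ℕ} (hk : 1 ≤ k) (hkm : k < m) :
    T k * X k * T k * X k = X k * T k * X k * T k := by
  induction k, hk using Nat.le_induction with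
  | base => exact H.refl_one hkm
  | succ k hk ih =>
    have hs := H.hecke.heckeInv_mul hk (by omega)
    have hT : T k * T (k + 1) * T k = T (k + 1) * (T k * T (k + 1)) := by
      rw [H.hecke.braid k hk hkm, mul_assoc]
    have hX : T k * T (k + 1) * X k = X (k + 1) * (T k * T (k + 1)) := by
      have hc : T (k + 1) * X k = X k * T (k + 1) :=
        H.braidStrand.commute_gt hk (Nat.lt_succ_self k) hkm
      rw [H.succ k hk (by omega), mul_assoc, hc]
      simp only [mul_assoc]
      rw [← mul_assoc (heckeInv q T k), hs, one_mul]
    have hunit : IsUnit (T k * T (k + 1)) :=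
      IsUnit.mul ⟨⟨T k, _, H.hecke.mul_heckeInv hk (by omega), hs⟩, rfl⟩
        ⟨⟨T (k + 1), _, H.hecke.mul_heckeInv (Nat.succ_pos k) hkm,
          H.hecke.heckeInv_mul (Nat.succ_pos k) hkm⟩, rfl⟩
    refine hunit.mul_right_cancel ?_
    generalize T k * T (k + 1) = G at *
    calc T (k + 1) * X (k + 1) * T (k + 1) * X (k + 1) * G
        = G * (T k * X k * T k * X k) := by
          simp only [mul_assoc, ← hX]
          simp only [← mul_assoc, hT, hX]
          simp only [mul_assoc, hX, hT]
      _ = X (k + 1) * T (k + 1) * X (k + 1) * T (k + 1) * G := by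
          rw [ih (by omega)]
          simp only [mul_assoc, ← hT]
          simp only [← mul_assoc, hT, hX]
          simp only [mul_assoc, hX, hT]

lemma commute_jmInv_strand (H : ReflectionSystem q m T y X) {j l : ℕ} (hj : 1 ≤ j) (hjl : j < l)
    (hl : l ≤ m) : Commute (jmInv q T j) (X l) :=
  have h : ∀ k, 1 ≤ k → k < j → Commute (heckeInv q T k) (X l) := fun k h1 h2 =>
    commute_heckeInv (H.braidStrand.commute_lt h1 (by omega) hl)
  H.hecke.inverse.braidStrand.commute_of_commute (by omega) (Commute.one_left _) h h j hj le_rfl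

end ReflectionSystem

/-- The factors `X k + z (y k)⁻¹`. -/
def reflFactor (q z : ℂ) (T X : ℕ → B) (k : ℕ) : B := X k + z • jmInv q T k

namespace ReflectionSystem

variable (z : ℂ)

lemma commute_reflFactor (H : ReflectionSystem q m T y X) {k l : ℕ} (hl : 1 ≤ l) (hlm : l < m)
    (hk : 1 ≤ k) (hkm : k ≤ m) (h1 : k ≠ l) (h2 : k ≠ l + 1) :
    Commute (T l) (reflFactor q z T X k) :=
  (H.braidStrand.commute_of_ne hl hlm hk hkm h1 h2).add_right
    ((commute_of_heckeInv
      (H.hecke.inverse.braidStrand.commute_of_ne hl hlm hk hkm h1 h2)).smul_right _)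

lemma commute_jmInv_reflFactor (H : ReflectionSystem q m T y X) {j l : ℕ} (hj : 1 ≤ j)
    (hjl : j < l) (hl : l ≤ m) : Commute (jmInv q T j) (reflFactor q z T X l) :=
  (H.commute_jmInv_strand hj hjl hl).add_right
    ((H.hecke.inverse.y_comm hj (by omega) (by omega) hl).smul_right _)

lemma commute_reflFactor_mul (H : ReflectionSystem q m T y X) {k : ℕ} (hk : 1 ≤ k)
    (hkm : k < m) :
    Commute (T k) (reflFactor q z T X k * reflFactor q z T X (k + 1)) := by
  have hX := H.succ k hk hkm
  have hJ : jmInv q T (k + 1) = _ := jmInv_succ hk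
  have hJX : jmInv q T k * X (k + 1) = X (k + 1) * jmInv q T k :=
    H.commute_jmInv_strand hk (Nat.lt_succ_self k) hkm
  have hJJ : jmInv q T k * jmInv q T (k + 1) = jmInv q T (k + 1) * jmInv q T k :=
    H.hecke.inverse.y_comm hk hkm.le (Nat.succ_pos k) hkm
  have hR := H.reflection hk hkm
  have a1 := H.hecke.mul_heckeInv hk hkm
  have a2 := H.hecke.heckeInv_mul hk hkm
  have a3 := H.hecke.sq k hk hkm
  have a4 := H.hecke.heckeInv_sq hk hkm
  simp only [reflFactor]
  generalize jmInv q T (k + 1) = J' at *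
  generalize X (k + 1) = X' at *
  generalize heckeInv q T k = s at *
  generalize jmInv q T k = J at *
  generalize X k = x at *
  generalize T k = t at *
  have hXX : Commute t (x * X') := by
    rw [commute_iff_eq, hX]
    calc t * (x * (t * x * s)) = (t * x * t * x) * s := by simp only [mul_assoc]
      _ = x * t * x * (t * s) := by rw [hR]; simp only [mul_assoc]
      _ = x * (t * x * s) * t := by simp only [mul_assoc, a1, a2]
  have hJJt : Commute t (J * J') := by
    rw [commute_iff_eq]
    nth_rewrite 1 [hJJ]
    rw [hJ]
    calc t * (s * J * s * J) = (t * s) * (J * s * J) := by simp only [mul_assoc]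
      _ = J * (s * J * s) * t := by rw [a1]; simp only [mul_assoc, a2, one_mul, mul_one]
  have hmid : Commute t (x * J' + J * X') := by
    have e1 : (x * J' + J * X') * t = x * s * J + J * t * x := by
      rw [hJ, hX, add_mul]
      simp only [mul_assoc, a2, mul_one]
    have e2 : t * (x * J') = J * t * x - (q - q⁻¹) • (X' * J) := by
      calc t * (x * J') = (X' * J) * s := by rw [hJ, hX]; simp only [mul_assoc]
        _ = J * (t * x) * (s * s) := by rw [← hJX, hX]; simp only [mul_assoc]
        _ = J * t * x - (q - q⁻¹) • (J * X') := by
          rw [a4, hX]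
          simp only [mul_sub, mul_one, mul_smul_comm, mul_assoc]
        _ = _ := by rw [hJX]
    have e3 : t * (J * X') = (q - q⁻¹) • (X' * J) + x * s * J := by
      calc t * (J * X') = (t * t) * (x * s * J) := by rw [hJX, hX]; simp only [mul_assoc]
        _ = _ := by
          rw [a3, hX]
          simp only [add_mul, one_mul, smul_mul_assoc, mul_assoc]
    rw [commute_iff_eq, e1, mul_add, e2, e3]
    abel
  have : (x + z • J) * (X' + z • J') = x * X' + z • (x * J' + J * X') + (z * z) • (J * J') := by
    simp only [add_mul, mul_add, smul_mul_assoc, mul_smul_comm, smul_add, smul_smul]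
    abel
  rw [this]
  exact (hXX.add_right (hmid.smul_right _)).add_right (hJJt.smul_right _)

/-- The Hecke generators commute with the product of all the factors. -/
lemma commute_prod_reflFactor (H : ReflectionSystem q m T y X) {k : ℕ} (hk : 1 ≤ k)
    (hkm : k < m) :
    Commute (T k) ((List.range m).map fun j => reflFactor q z T X (j + 1)).prod := by
  have hsplit : List.range m =
      List.range' 0 (k - 1) ++ ([k - 1, k] ++ List.range' (k + 1) (m - (k + 1))) := by
    have h2 : [k - 1, k] = List.range' (k - 1) 2 := by
      simp [List.range'_succ, Nat.sub_add_cancel hk]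
    have h3 := List.range'_append (s := k - 1) (m := 2) (n := m - (k + 1)) (step := 1)
    have h4 := List.range'_append (s := 0) (m := k - 1) (n := 2 + (m - (k + 1))) (step := 1)
    rw [show k - 1 + 1 * 2 = k + 1 by omega] at h3
    rw [show 0 + 1 * (k - 1) = k - 1 by omega,
      show k - 1 + (2 + (m - (k + 1))) = m by omega] at h4
    rw [h2, h3, h4, List.range_eq_range']
  rw [hsplit]
  simp only [List.map_append, List.prod_append, List.map_cons, List.map_nil, List.prod_cons,
    List.prod_nil, mul_one, Nat.sub_add_cancel hk]
  refine Commute.mul_right (Commute.list_prod_right _ _ ?_)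
    ((H.commute_reflFactor_mul z hk hkm).mul_right (Commute.list_prod_right _ _ ?_))
  all_goals
    intro x hx
    obtain ⟨j, hj, rfl⟩ := List.mem_map.mp hx
    have := List.mem_range'_1.mp hj
    exact H.commute_reflFactor z hk hkm (by omega) (by omega) (by omega) (by omega)

/-- On a weight space, the inverse Jucys–Murphy elements may be replaced by scalars in the
product of the factors. -/
lemma prod_mul_eq (H : ReflectionSystem q m T y X) (hq : q ≠ 0) {a : ℕ → ℤ} {E : B}
    (hE : E ∈ weightSpace q y m a) {s d : ℕ} (hsd : s + d = m) :
    ((List.range' s d).map fun k => X (k + 1) + (z * q ^ (-2 * a (k + 1))) • 1).prod * E =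
      ((List.range' s d).map fun k => reflFactor q z T X (k + 1)).prod * E := by
  induction d generalizing s with
  | zero => rfl
  | succ d ih =>
    have hJ : Commute (jmInv q T (s + 1))
        ((List.range' (s + 1) d).map fun k => reflFactor q z T X (k + 1)).prod := by
      refine Commute.list_prod_right _ _ fun x hx => ?_
      obtain ⟨j, hj, rfl⟩ := List.mem_map.mp hx
      have := List.mem_range'_1.mp hj
      exact H.commute_jmInv_reflFactor z (by omega) (by omega) (by omega)
    rw [List.range'_succ, List.map_cons, List.map_cons, List.prod_cons, List.prod_cons, mul_assoc,
      mul_assoc, ih (by omega), reflFactor, add_mul, add_mul, smul_mul_assoc, smul_mul_assoc,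
      one_mul, ← mul_assoc (jmInv q T (s + 1)), hJ.eq, mul_assoc _ (jmInv q T (s + 1)),
      H.hecke.jmInv_mul_of_mem hq hE (by omega) (by omega), mul_smul_comm, smul_smul]

end ReflectionSystem

end Reflection

/-! ### Operators on tensor legs -/

section Legs

variable {A : Type} [Ring A] {n m : ℕ}

/-- A matrix over `A` on two tensor legs, placed in the legs `a` and `b`. -/
def legPair (a b : Fin m) (M : Matrix (Fin n × Fin n) (Fin n × Fin n) A) :
    Matrix (Fin m → Fin n) (Fin m → Fin n) A := fun i j =>
  if ∀ c, c ≠ a → c ≠ b → i c = j c then M (i a, i b) (j a, j b) else 0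

lemma leg1_apply (X : Matrix (Fin n) (Fin n) A) (a : Fin m) (i j : Fin m → Fin n) :
    leg1 n m X a i j = if ∀ c, c ≠ a → i c = j c then X (i a) (j a) else 0 := by
  simp [leg1, Fin.val_inj]

lemma leg2_eq_legPair [Algebra ℂ A] (C : Matrix (Fin n × Fin n) (Fin n × Fin n) ℂ)
    (a b : Fin m) : leg2 A n m C a b = legPair a b (C.map (algebraMap ℂ A)) := by
  ext i j
  simp [leg2, legPair, Fin.val_inj]

lemma leg1_eq_legPair (X : Matrix (Fin n) (Fin n) A) {a b : Fin m} (hab : a ≠ b) :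
    leg1 n m X a = legPair a b (M1 X) := by
  ext i j
  rw [leg1_apply, legPair]
  by_cases h : ∀ c, c ≠ a → i c = j c
  · rw [if_pos h, if_pos fun c hc _ => h c hc]
    exact (if_pos (h b hab.symm)).symm
  · rw [if_neg h]
    split_ifs with h'
    · refine (if_neg fun hb => h fun c hc => ?_).symm
      by_cases hcb : c = b
      · rw [hcb]; exact hb
      · exact h' c hc hcb
    · rfl

lemma sum_ite_agree (a b : Fin m) (hab : a ≠ b) (i : Fin m → Fin n) (f : (Fin m → Fin n) → A) :
    ∑ k, (if ∀ c, c ≠ a → c ≠ b → i c = k c then f k else 0) =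
      ∑ p : Fin n × Fin n, f (Function.update (Function.update i a p.1) b p.2) := by
  rw [← Finset.sum_filter]
  refine Finset.sum_nbij' (fun k => (k a, k b))
    (fun p => Function.update (Function.update i a p.1) b p.2) (fun _ _ => Finset.mem_univ _)
    (fun p _ => ?_) (fun k hk => ?_) (fun p _ => ?_) (fun k hk => ?_)
  · simp only [Finset.mem_filter, Finset.mem_univ, true_and]
    intro c hca hcb
    simp [hca, hcb]
  · have hk' := (Finset.mem_filter.mp hk).2
    funext c
    by_cases hcb : c = b
    · simp [hcb]
    · by_cases hca : c = a
      · simp [hca, hab]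
      · simp [hca, hcb, hk' c hca hcb]
  · simp [hab]
  · congr 1
    have hk' := (Finset.mem_filter.mp hk).2
    funext c
    by_cases hcb : c = b
    · simp [hcb]
    · by_cases hca : c = a
      · simp [hca, hab]
      · simp [hca, hcb, hk' c hca hcb]

lemma legPair_mul {a b : Fin m} (hab : a ≠ b) (M N : Matrix (Fin n × Fin n) (Fin n × Fin n) A) :
    legPair a b M * legPair a b N = legPair a b (M * N) := by
  ext i j
  simp only [Matrix.mul_apply, legPair, ite_mul, zero_mul]
  rw [sum_ite_agree a b hab i]
  have key : ∀ p : Fin n × Fin n,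
      (∀ c, c ≠ a → c ≠ b → Function.update (Function.update i a p.1) b p.2 c = j c) ↔
        ∀ c, c ≠ a → c ≠ b → i c = j c := fun p =>
    forall_congr' fun c => imp_congr_right fun hca => imp_congr_right fun hcb => by
      simp [hca, hcb]
  simp only [key]
  split_ifs
  · simp [hab]
  · simp

lemma legPair_sub (a b : Fin m) (M N : Matrix (Fin n × Fin n) (Fin n × Fin n) A) :
    legPair a b (M - N) = legPair a b M - legPair a b N := by
  ext i j
  simp only [legPair, Matrix.sub_apply]
  split_ifs <;> simp

lemma legPair_smul [Algebra ℂ A] (a b : Fin m) (c : ℂ)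
    (M : Matrix (Fin n × Fin n) (Fin n × Fin n) A) :
    legPair a b (c • M) = c • legPair a b M := by
  ext i j
  simp only [legPair, Matrix.smul_apply]
  split_ifs <;> simp

lemma legPair_one (a b : Fin m) :
    legPair a b (1 : Matrix (Fin n × Fin n) (Fin n × Fin n) A) = 1 := by
  ext i j
  simp only [legPair, Matrix.one_apply, Prod.mk.injEq]
  by_cases h : i = j
  · simp [h]
  · rw [if_neg h]
    split_ifs with h1 h2
    · refine absurd (funext fun c => ?_) h
      by_cases hca : c = a
      · rw [hca]; exact h2.1
      · by_cases hcb : c = b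
        · rw [hcb]; exact h2.2
        · exact h1 c hca hcb
    · rfl
    · rfl

lemma commute_leg1_legPair [Algebra ℂ A] (X : Matrix (Fin n) (Fin n) A)
    (C : Matrix (Fin n × Fin n) (Fin n × Fin n) ℂ) {a b c : Fin m} (hab : a ≠ b) (hac : a ≠ c) :
    Commute (legPair b c (C.map (algebraMap ℂ A))) (leg1 n m X a) := by
  rw [commute_iff_eq]
  ext i j
  simp only [Matrix.mul_apply]
  rw [Finset.sum_eq_single (Function.update j a (i a)), Finset.sum_eq_single
    (Function.update i a (j a))]
  · have h1 : (∀ d, d ≠ b → d ≠ c → i d = Function.update j a (i a) d) ↔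
        ∀ d, d ≠ b → d ≠ c → Function.update i a (j a) d = j d :=
      forall_congr' fun d => imp_congr_right fun hb => imp_congr_right fun hc => by
        by_cases hd : d = a <;> simp [hd]
    simp only [leg1_apply, legPair, h1, Matrix.map_apply, Function.update_of_ne hab.symm,
      Function.update_of_ne hac.symm, Function.update_self]
    rw [if_pos fun d hd => Function.update_of_ne hd _ _,
      if_pos fun d hd => (Function.update_of_ne hd _ _).symm]
    split_ifs
    · exact Algebra.commutes _ _
    · simp
  · intro k _ hk
    by_cases h : ∀ d, d ≠ a → i d = k d
    · rw [legPair, if_neg, mul_zero]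
      refine fun h' => hk (funext fun d => ?_)
      by_cases hd : d = a
      · rw [hd, Function.update_self]; exact h' a hab hac
      · rw [Function.update_of_ne hd]; exact (h d hd).symm
    · rw [leg1_apply, if_neg h, zero_mul]
  · simp
  · intro k _ hk
    by_cases h : ∀ d, d ≠ a → k d = j d
    · rw [legPair, if_neg, zero_mul]
      refine fun h' => hk (funext fun d => ?_)
      by_cases hd : d = a
      · rw [hd, Function.update_self]; exact (h' a hab hac).symm
      · rw [Function.update_of_ne hd]; exact h d hd
    · rw [leg1_apply, if_neg h, mul_zero]
  · simp

end Legs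

/-! ### The braiding `Ř` -/

lemma Pmat_mul_apply {F : Type} [Ring F] {n : ℕ} (f : ℂ →+* F)
    (M : Matrix (Fin n × Fin n) (Fin n × Fin n) F) (p r : Fin n × Fin n) :
    ((Pmat n).map f * M) p r = M p.swap r := by
  rw [Matrix.mul_apply, Finset.sum_eq_single p.swap]
  · simp [Pmat]
  · intro s _ hs
    have : Pmat n p s = 0 := if_neg fun h => hs (Prod.ext h.2.symm h.1.symm)
    rw [Matrix.map_apply, this, map_zero, zero_mul]
  · simp

lemma mul_Pmat_apply {F : Type} [Ring F] {n : ℕ} (f : ℂ →+* F)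
    (M : Matrix (Fin n × Fin n) (Fin n × Fin n) F) (p r : Fin n × Fin n) :
    (M * (Pmat n).map f) p r = M p r.swap := by
  rw [Matrix.mul_apply, Finset.sum_eq_single r.swap]
  · simp [Pmat]
  · intro s _ hs
    have : Pmat n s r = 0 := if_neg fun h => hs (Prod.ext h.1 h.2)
    rw [Matrix.map_apply, this, map_zero, mul_zero]
  · simp

lemma Rcheck_apply (q : ℂ) (n : ℕ) (p r : Fin n × Fin n) :
    Rcheck q n p r = Rmat q n p.swap r := by
  have := Pmat_mul_apply (RingHom.id ℂ) (Rmat q n) p r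
  rwa [RingHom.coe_id, Matrix.map_id] at this

lemma Rcheck_mul_apply (q : ℂ) {n : ℕ} (M : Matrix (Fin n × Fin n) (Fin n × Fin n) ℂ)
    (p r : Fin n × Fin n) :
    (Rcheck q n * M) p r = (if p.1 = p.2 then q else 1) * M (p.2, p.1) r +
      (if p.2 < p.1 then q - q⁻¹ else 0) * M p r := by
  have : ∀ s, Rcheck q n p s * M s r =
      (if s = (p.2, p.1) then (if p.1 = p.2 then q else 1) * M s r else 0) +
        if s = p then (if p.2 < p.1 then q - q⁻¹ else 0) * M s r else 0 := by
    rintro ⟨s1, s2⟩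
    obtain ⟨p1, p2⟩ := p
    rw [Rcheck_apply]
    simp only [Rmat, Prod.swap, Prod.mk.injEq, eq_comm (a := s1), eq_comm (a := s2)]
    by_cases h1 : p2 = s1 ∧ p1 = s2
    · obtain ⟨rfl, rfl⟩ := h1
      by_cases h : p1 = p2
      · subst h; simp
      · simp [h, Ne.symm h]
    · rw [if_neg h1, if_neg h1]
      by_cases h2 : p1 = s1 ∧ p2 = s2
      · obtain ⟨rfl, rfl⟩ := h2; simp
      · rw [if_neg h2, if_neg fun h => h2 ⟨h.1, h.2.1⟩]; simp
  rw [Matrix.mul_apply, Finset.sum_congr rfl fun s _ => this s, Finset.sum_add_distrib]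
  simp

lemma Rcheck_sq {q : ℂ} (hq : q ≠ 0) (n : ℕ) :
    Rcheck q n * Rcheck q n = (q - q⁻¹) • Rcheck q n + 1 := by
  ext p r
  have h1 := fun s => Rcheck_mul_apply q (1 : Matrix (Fin n × Fin n) (Fin n × Fin n) ℂ) s r
  simp only [mul_one] at h1
  rw [Rcheck_mul_apply, Matrix.add_apply, Matrix.smul_apply, h1, h1]
  obtain ⟨p1, p2⟩ := p
  simp only [smul_eq_mul]
  rcases lt_trichotomy p1 p2 with h | h | h
  · simp [h.ne, h.ne', h, h.asymm]; ring
  · subst h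
    simp
    field_simp
    ring
  · simp [h.ne, h.ne', h, h.asymm]; ring

lemma Rcheck_inv {q : ℂ} (hq : q ≠ 0) (n : ℕ) :
    (Rcheck q n)⁻¹ = Rcheck q n - (q - q⁻¹) • 1 := by
  refine Matrix.inv_eq_right_inv ?_
  rw [mul_sub, Rcheck_sq hq, mul_smul_comm, mul_one, add_sub_cancel_left]

lemma RcLegInv_eq {A : Type} [Ring A] [Algebra ℂ A] {q : ℂ} (hq : q ≠ 0) (n : ℕ) {m k : ℕ}
    (hk : k + 1 < m) :
    RcLegInv A q n m k = RcLeg A q n m k - (q - q⁻¹) • 1 := by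
  have h := fun C => leg2_eq_legPair (A := A) (n := n) C (⟨k, by omega⟩ : Fin m) ⟨k + 1, hk⟩
  have hmap : (Rcheck q n - (q - q⁻¹) • 1).map (algebraMap ℂ A) =
      (Rcheck q n).map (algebraMap ℂ A) - (q - q⁻¹) • 1 := by
    ext i j
    simp only [Matrix.map_apply, Matrix.sub_apply, Matrix.smul_apply, map_sub, smul_eq_mul,
      Matrix.one_apply]
    split_ifs <;> simp [Algebra.smul_def]
  rw [RcLegInv, RcLeg, h, h, Rcheck_inv hq, hmap, legPair_sub, legPair_smul, legPair_one]

/-! ### The reflection equation -/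

lemma M1_mul {F : Type} [Ring F] {n : ℕ} (X Y : Matrix (Fin n) (Fin n) F) :
    M1 X * M1 Y = M1 (X * Y) := by
  ext p r
  simp only [Matrix.mul_apply, M1, Fintype.sum_prod_type]
  by_cases h : p.2 = r.2
  · simp [h]
  · simp only [h, if_false]
    refine Finset.sum_eq_zero fun i _ => Finset.sum_eq_zero fun j _ => ?_
    by_cases h1 : p.2 = j
    · simp [← h1, h]
    · simp [h1]

lemma M2_mul {F : Type} [Ring F] {n : ℕ} (X Y : Matrix (Fin n) (Fin n) F) :
    M2 X * M2 Y = M2 (X * Y) := by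
  ext p r
  simp only [Matrix.mul_apply, M2, Fintype.sum_prod_type]
  rw [Finset.sum_comm]
  by_cases h : p.1 = r.1
  · simp [h]
  · simp only [h, if_false]
    refine Finset.sum_eq_zero fun i _ => Finset.sum_eq_zero fun j _ => ?_
    by_cases h1 : p.1 = j
    · simp [← h1, h]
    · simp [h1]

lemma M1_one {F : Type} [Ring F] {n : ℕ} : M1 (1 : Matrix (Fin n) (Fin n) F) = 1 := by
  ext p r
  by_cases h1 : p.1 = r.1 <;> by_cases h2 : p.2 = r.2 <;>
    simp [M1, Matrix.one_apply, Prod.ext_iff, h1, h2]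

lemma M2_one {F : Type} [Ring F] {n : ℕ} : M2 (1 : Matrix (Fin n) (Fin n) F) = 1 := by
  ext p r
  by_cases h1 : p.1 = r.1 <;> by_cases h2 : p.2 = r.2 <;>
    simp [M2, Matrix.one_apply, Prod.ext_iff, h1, h2]

lemma Pmat_mul_M1 {F : Type} [Ring F] {n : ℕ} (f : ℂ →+* F) (X : Matrix (Fin n) (Fin n) F) :
    (Pmat n).map f * M1 X = M2 X * (Pmat n).map f := by
  ext p r
  rw [Pmat_mul_apply, mul_Pmat_apply]
  rfl

lemma Pmat_mul_M2 {F : Type} [Ring F] {n : ℕ} (f : ℂ →+* F) (X : Matrix (Fin n) (Fin n) F) :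
    (Pmat n).map f * M2 X = M1 X * (Pmat n).map f := by
  ext p r
  rw [Pmat_mul_apply, mul_Pmat_apply]
  rfl

/-- The reflection equation for `a₁ k₁` follows from the `RLL` relations for `a` and `b = k⁻¹`. -/
lemma reflection_of_rll {B : Type} [Monoid B] {p r a₁ a₂ b₁ b₂ k₁ k₂ : B}
    (ha : r * a₁ * a₂ = a₂ * a₁ * r) (hb : r * b₁ * b₂ = b₂ * b₁ * r)
    (hab : r * a₁ * b₂ = b₂ * a₁ * r) (hpa₁ : p * a₁ = a₂ * p) (hpa₂ : p * a₂ = a₁ * p)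
    (hpb₁ : p * b₁ = b₂ * p) (hpb₂ : p * b₂ = b₁ * p) (hpk₂ : p * k₂ = k₁ * p)
    (h₁ : b₁ * k₁ = 1) (h₁' : k₁ * b₁ = 1) (h₂ : b₂ * k₂ = 1) (h₂' : k₂ * b₂ = 1) :
    p * r * (a₁ * k₁) * (p * r) * (a₁ * k₁) = a₁ * k₁ * (p * r) * (a₁ * k₁) * (p * r) := by
  have haa : p * r * (a₁ * a₂) = a₁ * a₂ * (p * r) := by
    calc p * r * (a₁ * a₂) = p * (r * a₁ * a₂) := by simp only [mul_assoc]
      _ = (p * a₂) * a₁ * r := by rw [ha]; simp only [mul_assoc]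
      _ = a₁ * (p * a₁) * r := by rw [hpa₂]; simp only [mul_assoc]
      _ = a₁ * a₂ * (p * r) := by rw [hpa₁]; simp only [mul_assoc]
  have hbb : p * r * (b₁ * b₂) = b₁ * b₂ * (p * r) := by
    calc p * r * (b₁ * b₂) = p * (r * b₁ * b₂) := by simp only [mul_assoc]
      _ = (p * b₂) * b₁ * r := by rw [hb]; simp only [mul_assoc]
      _ = b₁ * (p * b₁) * r := by rw [hpb₂]; simp only [mul_assoc]
      _ = b₁ * b₂ * (p * r) := by rw [hpb₁]; simp only [mul_assoc]
  have hk : k₂ * k₁ * (b₁ * b₂) = 1 := by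
    rw [mul_assoc, ← mul_assoc k₁, h₁', one_mul, h₂']
  have hk' : b₁ * b₂ * (k₂ * k₁) = 1 := by
    rw [mul_assoc, ← mul_assoc b₂, h₂, one_mul, h₁]
  have hkk : p * r * (k₂ * k₁) = k₂ * k₁ * (p * r) := by
    calc p * r * (k₂ * k₁) = k₂ * k₁ * (b₁ * b₂ * (p * r)) * (k₂ * k₁) := by
          rw [← mul_assoc (k₂ * k₁), hk, one_mul]
      _ = k₂ * k₁ * (p * r) * (b₁ * b₂ * (k₂ * k₁)) := by
          rw [← hbb]; simp only [mul_assoc]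
      _ = k₂ * k₁ * (p * r) := by rw [hk', mul_one]
  have hak : k₂ * r * a₁ = a₁ * r * k₂ := by
    calc k₂ * r * a₁ = k₂ * (r * a₁ * b₂) * k₂ := by
          simp only [mul_assoc, h₂, mul_one]
      _ = (k₂ * b₂) * (a₁ * r * k₂) := by rw [hab]; simp only [mul_assoc]
      _ = a₁ * r * k₂ := by rw [h₂', one_mul]
  have hmid : k₁ * (p * r) * a₁ = a₂ * (p * r) * k₂ := by
    calc k₁ * (p * r) * a₁ = (k₁ * p) * r * a₁ := by simp only [mul_assoc]
      _ = p * (k₂ * r * a₁) := by rw [← hpk₂]; simp only [mul_assoc]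
      _ = (p * a₁) * r * k₂ := by rw [hak]; simp only [mul_assoc]
      _ = a₂ * (p * r) * k₂ := by rw [hpa₁]; simp only [mul_assoc]
  generalize p * r = c at *
  calc c * (a₁ * k₁) * c * (a₁ * k₁) = c * a₁ * (k₁ * c * a₁) * k₁ := by simp only [mul_assoc]
    _ = (c * (a₁ * a₂)) * c * k₂ * k₁ := by rw [hmid]; simp only [mul_assoc]
    _ = a₁ * a₂ * c * (c * (k₂ * k₁)) := by rw [haa]; simp only [mul_assoc]
    _ = a₁ * (a₂ * c * k₂) * k₁ * c := by rw [hkk]; simp only [mul_assoc]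
    _ = a₁ * k₁ * c * (a₁ * k₁) * c := by rw [← hmid]; simp only [mul_assoc]

section Uq

variable (q : ℂ) (n : ℕ)

lemma map_RmatU : (RmatU q n).map (RingQuot.mkAlgHom ℂ (UqRel q n)) =
    (Rmat q n).map (algebraMap ℂ (Uq q n)) := by
  ext x y
  exact AlgHom.commutes _ _

lemma map_M1_lpF : (M1 (lpF n)).map (RingQuot.mkAlgHom ℂ (UqRel q n)) = M1 (Lp q n) := by
  ext x y
  simp only [M1, Matrix.map_apply, apply_ite (RingQuot.mkAlgHom ℂ (UqRel q n)), map_zero]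
  rfl

lemma map_M2_lpF : (M2 (lpF n)).map (RingQuot.mkAlgHom ℂ (UqRel q n)) = M2 (Lp q n) := by
  ext x y
  simp only [M2, Matrix.map_apply, apply_ite (RingQuot.mkAlgHom ℂ (UqRel q n)), map_zero]
  rfl

lemma map_M1_lmF : (M1 (lmF n)).map (RingQuot.mkAlgHom ℂ (UqRel q n)) = M1 (Lm q n) := by
  ext x y
  simp only [M1, Matrix.map_apply, apply_ite (RingQuot.mkAlgHom ℂ (UqRel q n)), map_zero]
  rfl

lemma map_M2_lmF : (M2 (lmF n)).map (RingQuot.mkAlgHom ℂ (UqRel q n)) = M2 (Lm q n) := by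
  ext x y
  simp only [M2, Matrix.map_apply, apply_ite (RingQuot.mkAlgHom ℂ (UqRel q n)), map_zero]
  rfl

lemma rll_plus_plus : (Rmat q n).map (algebraMap ℂ (Uq q n)) * M1 (Lp q n) * M2 (Lp q n) =
    M2 (Lp q n) * M1 (Lp q n) * (Rmat q n).map (algebraMap ℂ (Uq q n)) := by
  rw [← map_RmatU, ← map_M1_lpF, ← map_M2_lpF]
  simp only [← Matrix.map_mul]
  ext x y
  exact RingQuot.mkAlgHom_rel ℂ (UqRel.rllPP x y)

lemma rll_minus_minus : (Rmat q n).map (algebraMap ℂ (Uq q n)) * M1 (Lm q n) * M2 (Lm q n) =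
    M2 (Lm q n) * M1 (Lm q n) * (Rmat q n).map (algebraMap ℂ (Uq q n)) := by
  rw [← map_RmatU, ← map_M1_lmF, ← map_M2_lmF]
  simp only [← Matrix.map_mul]
  ext x y
  exact RingQuot.mkAlgHom_rel ℂ (UqRel.rllMM x y)

lemma rll_plus_minus : (Rmat q n).map (algebraMap ℂ (Uq q n)) * M1 (Lp q n) * M2 (Lm q n) =
    M2 (Lm q n) * M1 (Lp q n) * (Rmat q n).map (algebraMap ℂ (Uq q n)) := by
  rw [← map_RmatU, ← map_M1_lpF, ← map_M2_lmF]
  simp only [← Matrix.map_mul]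
  ext x y
  exact RingQuot.mkAlgHom_rel ℂ (UqRel.rllPM x y)

/-- The matrix `L` solves the reflection equation. -/
lemma Lmat_reflection {K : Matrix (Fin n) (Fin n) (Uq q n)} (hK1 : Lm q n * K = 1)
    (hK2 : K * Lm q n = 1) :
    (Rcheck q n).map (algebraMap ℂ (Uq q n)) * M1 (Lmat q n K) *
        (Rcheck q n).map (algebraMap ℂ (Uq q n)) * M1 (Lmat q n K) =
      M1 (Lmat q n K) * (Rcheck q n).map (algebraMap ℂ (Uq q n)) * M1 (Lmat q n K) *
        (Rcheck q n).map (algebraMap ℂ (Uq q n)) := by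
  rw [Rcheck, Matrix.map_mul, Lmat, ← M1_mul]
  refine reflection_of_rll (b₁ := M1 (Lm q n)) (k₂ := M2 K) (rll_plus_plus q n)
    (rll_minus_minus q n) (rll_plus_minus q n) (Pmat_mul_M1 _ _) (Pmat_mul_M2 _ _)
    (Pmat_mul_M1 _ _) (Pmat_mul_M2 _ _) (Pmat_mul_M2 _ _) ?_ ?_ ?_ ?_
  · rw [M1_mul, hK1, M1_one]
  · rw [M1_mul, hK2, M1_one]
  · rw [M2_mul, hK1, M2_one]
  · rw [M2_mul, hK2, M2_one]

end Uq

section Representation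

variable {q : ℂ} {n m : ℕ} {φ : Hecke q m →ₐ[ℂ] Matrix (Fin m → Fin n) (Fin m → Fin n) ℂ}

lemma IsHeckeRep.map_Tp (hφ : IsHeckeRep q n m φ) {k : ℕ} (hk : 1 ≤ k) (hkm : k < m) :
    φ (Tp q m k) = RcLeg ℂ q n m (k - 1) := hφ (k - 1) (by omega)

lemma commute_map_of_commute_Tp {C : Type} [Ring C] [Algebra ℂ C] (f : Hecke q m →ₐ[ℂ] C) {z : C}
    (hz : ∀ k, 1 ≤ k → k < m → Commute (f (Tp q m k)) z) (u : Hecke q m) : Commute (f u) z := by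
  have hu : u ∈ strandAlg (Tp q m) m := by rw [strandAlg_Tp_eq_top]; trivial
  induction hu using Algebra.adjoin_induction with
  | mem x hx =>
    obtain ⟨k, hk, rfl⟩ := hx
    exact hz k hk.1 hk.2
  | algebraMap r => rw [AlgHom.commutes]; exact Algebra.commutes _ _
  | add x y _ _ hx hy => rw [map_add]; exact hx.add_left hy
  | mul x y _ _ hx hy => rw [map_mul]; exact hx.mul_left hy

/-! ### Cyclicity of the q-trace -/

/-- The diagonal entries of `D₁ ⋯ D_m`. -/
def qDiag (q : ℂ) (n m : ℕ) (i : Fin m → Fin n) : ℂ := ∏ a : Fin m, q ^ (-2 * ((i a : ℕ) : ℤ))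

lemma qDiag_eq_of_RcLeg_ne_zero {k : ℕ} {i j : Fin m → Fin n} (h : RcLeg ℂ q n m k i j ≠ 0) :
    qDiag q n m i = qDiag q n m j := by
  by_cases hk : k < m ∧ k + 1 < m
  · let a : Fin m := ⟨k, hk.1⟩
    let b : Fin m := ⟨k + 1, hk.2⟩
    change leg2 ℂ n m (Rcheck q n) (a : ℕ) (b : ℕ) i j ≠ 0 at h
    rw [leg2_eq_legPair, legPair] at h
    split_ifs at h with hag
    · rw [Matrix.map_apply, Rcheck_apply, Rmat] at h
      have hcases : (i b = j a ∧ i a = j b) ∨ (i a = j a ∧ i b = j b) := by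
        by_contra hcon
        rw [not_or] at hcon
        exact h ((congrArg _ ((if_neg hcon.1).trans
          (if_neg fun h' => hcon.2 ⟨h'.1, h'.2.1⟩))).trans (map_zero _))
      rcases hcases with h' | h'
      · have hij : ∀ c, i c = j (Equiv.swap a b c) := fun c => by
          by_cases hca : c = a
          · rw [hca, Equiv.swap_apply_left]; exact h'.2
          · by_cases hcb : c = b
            · rw [hcb, Equiv.swap_apply_right]; exact h'.1
            · rw [Equiv.swap_apply_of_ne_of_ne hca hcb]; exact hag c hca hcb
        simp only [qDiag, hij]
        exact Equiv.prod_comp (Equiv.swap a b) fun c => q ^ (-2 * ((j c : ℕ) : ℤ))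
      · congr 1
        funext c
        by_cases hca : c = a
        · rw [hca]; exact h'.1
        · by_cases hcb : c = b
          · rw [hcb]; exact h'.2
          · exact hag c hca hcb
    · exact absurd rfl h
  · exact absurd (dif_neg hk) h

lemma IsHeckeRep.commute_diagonal (hφ : IsHeckeRep q n m φ) (u : Hecke q m) :
    Commute (φ u) (Matrix.diagonal (qDiag q n m)) := by
  refine commute_map_of_commute_Tp φ (fun k hk hkm => ?_) u
  rw [hφ.map_Tp hk hkm, commute_iff_eq]
  ext i j
  rw [Matrix.mul_diagonal, Matrix.diagonal_mul, mul_comm]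
  by_cases h : RcLeg ℂ q n m (k - 1) i j = 0
  · rw [h, mul_zero, mul_zero]
  · rw [qDiag_eq_of_RcLeg_ne_zero h]

lemma qTr_mul_comm {A : Type} [Ring A] [Algebra ℂ A]
    {M : Matrix (Fin m → Fin n) (Fin m → Fin n) ℂ}
    (hM : Commute M (Matrix.diagonal (qDiag q n m)))
    (N : Matrix (Fin m → Fin n) (Fin m → Fin n) A) :
    qTr q n m (N * M.map (algebraMap ℂ A)) = qTr q n m (M.map (algebraMap ℂ A) * N) := by
  have hij : ∀ i j, M j i * qDiag q n m i = qDiag q n m j * M j i := fun i j => by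
    rw [← Matrix.mul_diagonal, ← Matrix.diagonal_mul, hM.eq]
  simp only [qTr, Matrix.mul_apply, Finset.mul_sum, Matrix.map_apply]
  rw [Finset.sum_comm]
  refine Finset.sum_congr rfl fun j _ => Finset.sum_congr rfl fun i _ => ?_
  change algebraMap ℂ A (qDiag q n m i) * _ = algebraMap ℂ A (qDiag q n m j) * _
  rw [← Algebra.commutes (M j i) (N i j), ← mul_assoc, ← mul_assoc, ← map_mul, ← map_mul, ← hij,
    mul_comm]

/-- The q-trace as a linear map. -/
def qTrLinear (A : Type) [Ring A] [Algebra ℂ A] (q : ℂ) (n m : ℕ) :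
    Matrix (Fin m → Fin n) (Fin m → Fin n) A →ₗ[ℂ] A where
  toFun := qTr q n m
  map_add' M N := by simp only [qTr, Matrix.add_apply, mul_add, Finset.sum_add_distrib]
  map_smul' c M := by
    simp only [qTr, Matrix.smul_apply, mul_smul_comm, Finset.smul_sum, RingHom.id_apply]

/-! ### The Hecke algebra acting over an algebra of coefficients -/

/-- The extension of scalars of a representation of the Hecke algebra. -/
def extendRep (A : Type) [Ring A] [Algebra ℂ A]
    (φ : Hecke q m →ₐ[ℂ] Matrix (Fin m → Fin n) (Fin m → Fin n) ℂ) :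
    Hecke q m →ₐ[ℂ] Matrix (Fin m → Fin n) (Fin m → Fin n) A :=
  (Algebra.ofId ℂ A).mapMatrix.comp φ

lemma extendRep_apply (A : Type) [Ring A] [Algebra ℂ A] (u : Hecke q m) :
    extendRep A φ u = (φ u).map (algebraMap ℂ A) := rfl

lemma IsHeckeRep.extendRep_Tp (A : Type) [Ring A] [Algebra ℂ A] (hφ : IsHeckeRep q n m φ) {k : ℕ}
    (hk : 1 ≤ k) (hkm : k < m) : extendRep A φ (Tp q m k) = RcLeg A q n m (k - 1) := by
  rw [extendRep_apply, hφ.map_Tp hk hkm]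
  ext i j
  simp only [RcLeg, leg2, Matrix.map_apply]
  split_ifs <;> simp

lemma IsHeckeRep.reflectionSystem (hφ : IsHeckeRep q n m φ) (hq : q ≠ 0)
    {K : Matrix (Fin n) (Fin n) (Uq q n)} (hK1 : Lm q n * K = 1) (hK2 : K * Lm q n = 1) :
    ReflectionSystem q m (fun k => extendRep (Uq q n) φ (Tp q m k))
      (fun k => extendRep (Uq q n) φ (yJM q m k))
      (fun k => legBar q n m (Lmat q n K) (k - 1)) where
  hecke := (heckeSystem hq m).map (extendRep (Uq q n) φ)
  base k h1 h2 := by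
    have h := leg2_eq_legPair (A := Uq q n) (Rcheck q n) (⟨k - 1, by omega⟩ : Fin m)
      ⟨k - 1 + 1, by omega⟩
    have hc := commute_leg1_legPair (Lmat q n K) (Rcheck q n) (a := (⟨0, by omega⟩ : Fin m))
      (b := ⟨k - 1, by omega⟩) (c := ⟨k - 1 + 1, by omega⟩) (by simp; omega) (by simp)
    rw [← h] at hc
    rw [hφ.extendRep_Tp (Uq q n) (by omega) h2]
    exact hc
  succ k h1 h2 := by
    obtain ⟨l, rfl⟩ : ∃ l, k = l + 1 := ⟨k - 1, by omega⟩
    simp only [heckeInv]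
    rw [hφ.extendRep_Tp (Uq q n) h1 h2, Nat.add_sub_cancel, Nat.add_sub_cancel,
      ← RcLegInv_eq hq n h2]
    rfl
  refl_one h := by
    have h2 := leg2_eq_legPair (A := Uq q n) (Rcheck q n) (⟨0, by omega⟩ : Fin m) ⟨1, h⟩
    have hab : (⟨0, by omega⟩ : Fin m) ≠ ⟨1, h⟩ := by simp
    have h3 : legBar q n m (Lmat q n K) 0 = _ := leg1_eq_legPair (Lmat q n K) hab
    have h4 : RcLeg (Uq q n) q n m 0 = _ := h2
    simp only [hφ.extendRep_Tp (Uq q n) le_rfl h, Nat.sub_self, h3, h4, legPair_mul hab,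
      Lmat_reflection q n hK1 hK2]

end Representation

/-- the q-immanant polynomial `S_U(z)` depends only on the shape `μ`, not on
the choice of standard `μ`-tableau. -/
theorem qimmanant_poly_tableau_independent (n : ℕ) (hn : 1 ≤ n) (q : ℂ) (hq : q ≠ 0)
    (hq' : NotRootOfUnity q) (m : ℕ) (μ : YoungDiagram) (hcard : μ.cells.card = m)
    (hrow : ∀ c ∈ μ.cells, c.1 < n) (U U' : StdTab μ m)
    (φ : Hecke q m →ₐ[ℂ] Matrix (Fin m → Fin n) (Fin m → Fin n) ℂ)
    (hφ : IsHeckeRep q n m φ)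
    (e e' : Hecke q m) (he : IsJMIdem q m U e) (he' : IsJMIdem q m U' e')
    (K : Matrix (Fin n) (Fin n) (Uq q n)) (hK1 : Lm q n * K = 1) (hK2 : K * Lm q n = 1)
    (z : ℂ) :
    SUpoly q n m U (φ e) (Lmat q n K) z = SUpoly q n m U' (φ e') (Lmat q n K) z := by
  have H := hφ.reflectionSystem hq hK1 hK2
  set Ψ := ((List.range m).map fun j => reflFactor q z (fun k => extendRep (Uq q n) φ (Tp q m k))
    (fun k => legBar q n m (Lmat q n K) (k - 1)) (j + 1)).prod with hΨ
  let χ : Hecke q m →ₗ[ℂ] Uq q n :=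
    qTrLinear (Uq q n) q n m ∘ₗ LinearMap.mulLeft ℂ Ψ ∘ₗ (extendRep (Uq q n) φ).toLinearMap
  have hχ : ∀ u v, χ (u * v) = χ (v * u) := fun u v => by
    have hc := commute_map_of_commute_Tp (extendRep (Uq q n) φ)
      (fun k hk hkm => H.commute_prod_reflFactor z hk hkm) v
    change qTr q n m (Ψ * extendRep (Uq q n) φ (u * v)) =
      qTr q n m (Ψ * extendRep (Uq q n) φ (v * u))
    rw [map_mul, map_mul, ← mul_assoc, ← mul_assoc, ← hc.eq, mul_assoc _ Ψ,
      extendRep_apply (Uq q n) v]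
    exact qTr_mul_comm (hφ.commute_diagonal v) _
  have hS : ∀ {V : StdTab μ m} {f : Hecke q m}, IsJMIdem q m V f →
      SUpoly q n m V (φ f) (Lmat q n K) z = χ f := fun {V f} hf => by
    have hw : extendRep (Uq q n) φ f ∈
        weightSpace q (fun k => extendRep (Uq q n) φ (yJM q m k)) m (ctnAt V) :=
      mem_weightSpace.mpr fun k h1 h2 => by
        rw [← map_mul, (hf.2.2 k h1 h2).1, map_smul]
        rfl
    change qTr q n m _ = qTr q n m (Ψ * extendRep (Uq q n) φ f)
    rw [hΨ, List.range_eq_range', ← H.prod_mul_eq z hq hw (Nat.zero_add m), ← List.range_eq_range']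
    rfl
  rw [hS he, hS he']
  exact trace_jmIdem_eq hq hq' χ hχ he he'

end QImm
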